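/- arXiv:2304.09470 — 7 statements merged into one kernel-verified Lean document; each statement's English description precedes it below -/
import Mathlib

section
/- For every integer n ≥ 0, the function B_n is entire (complex differentiable at every point of ℂ), and the set {k ∈ ℂ : B_n(k) = 0} is infinite. -/
open MeasureTheory intervalIntegral

/-- Bessel function of the first kind of integer order `n`. -/
noncomputable def besselJ (n : ℕ) (z : ℂ) : ℂ :=
  ∑' m : ℕ, ((-1) ^ m / ((Nat.factorial m : ℂ) * (Nat.factorial (m + n) : ℂ))) *
    (z / 2) ^ (2 * m + n)

/-- `B_n(k) = ∫_0^1 (t+1) J_n(kt)^2 dt`. -/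
noncomputable def BornB (n : ℕ) (k : ℂ) : ℂ :=
  ∫ t in (0:ℝ)..1, ((t : ℂ) + 1) * (besselJ n (k * t)) ^ 2

open Filter Topology

/-- A zero-free entire function of order at most one half is constant. -/
lemma const_of_growth (G : ℂ → ℂ) (hG : Differentiable ℂ G) (h0 : ∀ z, G z ≠ 0)
    (C B : ℝ) (hB : 0 ≤ B) (hb : ∀ z, ‖G z‖ ≤ C * Real.exp (B * √‖z‖)) (z : ℂ) :
    G z = G 0 := by
  have hd : Differentiable ℂ (fun z => deriv G z / G z) := by
    have h1 : Differentiable ℂ (deriv G) := by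
      intro z
      exact (hG.analyticAt z).deriv.differentiableAt
    exact h1.div hG h0
  obtain ⟨h, hh0, hh⟩ := hd.isExactOn_univ.with_val_at 0 (Complex.log (G 0))
  have hh' : ∀ x, HasDerivAt h (deriv G x / G x) x := fun x => hh x trivial
  have hexp : ∀ x, G x = Complex.exp (h x) := by
    have hder : ∀ x, HasDerivAt (fun x => G x * Complex.exp (-h x)) 0 x := by
      intro x
      have := (hG x).hasDerivAt.mul (hh' x).neg.cexp
      refine HasDerivAt.congr_deriv this ?_
      have := h0 x
      have e : deriv G x = G x * (deriv G x / G x) := by field_simp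
      linear_combination (Complex.exp (-h x)) * e
    intro x
    have h2 := is_const_of_deriv_eq_zero (fun x => (hder x).differentiableAt)
      (fun x => (hder x).deriv) x 0
    simp only [hh0, Complex.exp_neg, Complex.exp_log (h0 0)] at h2
    rw [mul_inv_cancel₀ (h0 0)] at h2
    have := Complex.exp_ne_zero (h x)
    field_simp at h2
    exact h2
  have hC : 0 < C := by
    have h1 := hb 0
    have h2 := norm_pos_iff.2 (h0 0)
    simp at h1
    linarith
  have hre : ∀ x, (h x).re ≤ Real.log C + B * √‖x‖ := by
    intro x
    have h1 := hb x
    rw [hexp, Complex.norm_exp] at h1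
    rw [← Real.exp_le_exp, Real.exp_add, Real.exp_log hC]
    exact h1
  have hkey : ∀ R : ℝ, ‖z‖ < R → ‖h z - h 0‖ ≤
      2 * ((|Real.log C| + 1 + ‖h 0‖) + B * √R) * ‖z‖ / (R - ‖z‖) := by
    intro R hR
    have hR0 : 0 < R := (norm_nonneg z).trans_lt hR
    refine Complex.borelCaratheodory_zero (f := fun z => h z - h 0) (by positivity) ?_ ?_ hR0
      (by simpa using hR) (by simp)
    · exact fun x _ => ((hh' x).differentiableAt.sub_const _).differentiableWithinAt
    · intro x hx
      have hx' : ‖x‖ < R := by simpa using hx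
      have h1 := hre x
      have h2 : √‖x‖ ≤ √R := Real.sqrt_le_sqrt hx'.le
      have h3 := mul_le_mul_of_nonneg_left h2 hB
      have h4 := Complex.abs_re_le_norm (h 0)
      have h5 := neg_abs_le (h 0).re
      have h6 := le_abs_self (Real.log C)
      show (h x - h 0).re ≤ _
      rw [Complex.sub_re]
      linarith
  have hlim : Tendsto (fun s : ℝ => 2 * ((|Real.log C| + 1 + ‖h 0‖) + B * √(s^2)) * ‖z‖ / (s^2 - ‖z‖))
      atTop (𝓝 0) := by
    have e : ∀ᶠ s : ℝ in atTop, 2 * ((|Real.log C| + 1 + ‖h 0‖) * s⁻¹ + B) * ‖z‖ * s⁻¹ / (1 - ‖z‖ * s⁻¹ * s⁻¹)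
      = 2 * ((|Real.log C| + 1 + ‖h 0‖) + B * √(s^2)) * ‖z‖ / (s^2 - ‖z‖) := by
      filter_upwards [eventually_gt_atTop (0:ℝ)] with s hs
      rw [Real.sqrt_sq hs.le]
      have e1 : 2 * (|Real.log C| + 1 + ‖h 0‖ + B * s) * ‖z‖ =
        (2 * ((|Real.log C| + 1 + ‖h 0‖) * s⁻¹ + B) * ‖z‖ * s⁻¹) * s ^ 2 := by field_simp
      have e2 : s ^ 2 - ‖z‖ = (1 - ‖z‖ * s⁻¹ * s⁻¹) * s ^ 2 := by field_simp
      rw [e1, e2, mul_div_mul_right _ _ (by positivity)]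
    refine Tendsto.congr' e ?_
    have hi : Tendsto (fun s : ℝ => s⁻¹) atTop (𝓝 0) := tendsto_inv_atTop_zero
    have n1 := ((((hi.const_mul (|Real.log C| + 1 + ‖h 0‖)).add_const B).const_mul 2).mul_const ‖z‖).mul hi
    have n2 := (((hi.const_mul ‖z‖).mul hi).const_sub 1)
    have := n1.div n2 (by simp)
    simp only [mul_zero, sub_zero, zero_div] at this
    exact this
  have hle : ‖h z - h 0‖ ≤ 0 := by
    refine ge_of_tendsto hlim ?_
    filter_upwards [eventually_gt_atTop (‖z‖ + 1)] with s hs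
    refine hkey _ ?_
    have := norm_nonneg z
    nlinarith
  have : h z = h 0 := sub_eq_zero.1 (norm_le_zero_iff.1 hle)
  rw [hexp, hexp 0, this]

/-- An entire function of order at most one half with finitely many zeros is a polynomial. -/
lemma poly_of_growth (S : Finset ℂ) : ∀ (F : ℂ → ℂ), Differentiable ℂ F →
    (∀ z, F z = 0 ↔ z ∈ S) → (∃ C B : ℝ, 0 ≤ B ∧ ∀ z, ‖F z‖ ≤ C * Real.exp (B * √‖z‖)) →
    ∃ P : Polynomial ℂ, ∀ z, F z = P.eval z := by
  induction S using Finset.induction_on with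
  | empty =>
    rintro F hF hz ⟨C, B, hB, hb⟩
    exact ⟨Polynomial.C (F 0), fun z => by
      simpa using const_of_growth F hF (fun z => by simp [hz]) C B hB hb z⟩
  | insert a S haS ih =>
    rintro F hF hz ⟨C, B, hB, hb⟩
    have hne : ¬ ∀ᶠ z in 𝓝 a, F z = 0 := by
      intro h
      have := AnalyticOnNhd.eq_of_eventuallyEq (f := F) (g := fun _ => 0)
        (fun x _ => hF.analyticAt x) analyticOnNhd_const (z₀ := a) h
      obtain ⟨y, hy⟩ := Infinite.exists_notMem_finset (insert a S)
      exact hy ((hz y).1 (congrFun this y))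
    obtain ⟨k, g, hg, hga, hgF⟩ := (hF.analyticAt a).exists_eventuallyEq_pow_smul_nonzero_iff.2 hne
    classical
    set F1 : ℂ → ℂ := fun z => if z = a then g a else F z / (z - a) ^ k with hF1
    have hmul : ∀ z, z ≠ a → F z = (z - a) ^ k * F1 z := by
      intro z hza
      have : z - a ≠ 0 := sub_ne_zero.2 hza
      simp only [hF1, if_neg hza]
      field_simp
    have hmul' : ∀ z, F z = (z - a) ^ k * F1 z := by
      intro z
      by_cases hza : z = a
      · subst hza
        have := hgF.self_of_nhds
        simpa [hF1] using this
      · exact hmul z hza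
    have hloc : F1 =ᶠ[𝓝 a] g := by
      filter_upwards [hgF] with z hz'
      by_cases hza : z = a
      · simp [hF1, hza]
      · have : z - a ≠ 0 := sub_ne_zero.2 hza
        simp only [hF1, if_neg hza, hz', smul_eq_mul]
        field_simp
    have hd : Differentiable ℂ F1 := by
      intro z
      by_cases hza : z = a
      · subst hza
        exact (hg.differentiableAt).congr_of_eventuallyEq hloc
      · have : F1 =ᶠ[𝓝 z] fun z => F z / (z - a) ^ k := by
          filter_upwards [isOpen_ne.mem_nhds hza] with y hy
          simp only [hF1, if_neg hy]
        refine DifferentiableAt.congr_of_eventuallyEq ?_ this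
        exact (hF z).div (by fun_prop) (pow_ne_zero _ (sub_ne_zero.2 hza))
    have hz1 : ∀ z, F1 z = 0 ↔ z ∈ S := by
      intro z
      by_cases hza : z = a
      · subst hza
        simp [hF1, hga, haS]
      · have h1 := hz z
        have h2 : (z - a) ^ k ≠ 0 := pow_ne_zero _ (sub_ne_zero.2 hza)
        rw [hmul' z] at h1
        simpa [h2, hza] using h1
    obtain ⟨K, hK⟩ := (isCompact_closedBall a 1).exists_bound_of_continuousOn
      (f := F1) hd.continuous.continuousOn
    obtain ⟨P, hP⟩ := ih F1 hd hz1 ⟨max C K, B, hB, by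
      intro z
      have hC : 0 ≤ max C K := by
        refine le_trans ?_ (le_max_right _ _)
        exact (norm_nonneg _).trans (hK a (by simp))
      by_cases hz1 : ‖z - a‖ ≤ 1
      · have h1 := hK z (by simpa [dist_eq_norm] using hz1)
        have h2 : 1 ≤ Real.exp (B * √‖z‖) := Real.one_le_exp (by positivity)
        have h3 := le_max_right C K
        nlinarith
      · push Not at hz1
        have h1 := hb z
        rw [hmul' z, norm_mul, norm_pow] at h1
        have h2 := one_le_pow₀ hz1.le (n := k)
        have h3 := le_max_left C K
        have h4 := Real.exp_pos (B * √‖z‖)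
        have h5 := norm_nonneg (F1 z)
        calc ‖F1 z‖ ≤ ‖z - a‖ ^ k * ‖F1 z‖ := by nlinarith
          _ ≤ _ := h1
          _ ≤ _ := by gcongr⟩
    refine ⟨(Polynomial.X - Polynomial.C a) ^ k * P, fun z => ?_⟩
    rw [hmul' z, hP z]
    simp

/-- Polynomials grow polynomially. -/
lemma poly_bound (P : Polynomial ℂ) : ∃ K : ℝ, ∀ s : ℝ, 1 ≤ s →
    ‖P.eval (-(s : ℂ))‖ ≤ K * s ^ P.natDegree := by
  refine ⟨∑ i ∈ Finset.range (P.natDegree + 1), ‖P.coeff i‖, fun s hs => ?_⟩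
  rw [Polynomial.eval_eq_sum_range, Finset.sum_mul]
  refine (norm_sum_le _ _).trans (Finset.sum_le_sum fun i hi => ?_)
  rw [norm_mul, norm_pow, norm_neg, Complex.norm_real, Real.norm_of_nonneg (by linarith)]
  have := Finset.mem_range.1 hi
  have h2 := pow_le_pow_right₀ hs (show i ≤ P.natDegree by omega)
  gcongr

/-- Holomorphic dependence on a parameter. -/
lemma differentiable_param (q p : ℝ → ℂ) (hq : Continuous q) (hp : Continuous p)
    (E : ℂ → ℂ) (hE : Differentiable ℂ E) :
    Differentiable ℂ (fun w => ∫ t in (0:ℝ)..1, q t * E (p t * w)) := by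
  intro w
  have hE' : Continuous (deriv E) := by
    have : Differentiable ℂ (deriv E) := fun z => (hE.analyticAt z).deriv.differentiableAt
    exact this.continuous
  have hEc := hE.continuous
  have hc : Continuous (fun x : ℂ × ℝ => q x.2 * (deriv E (p x.2 * x.1) * p x.2)) := by fun_prop
  obtain ⟨K, hK⟩ := ((isCompact_closedBall w 1).prod (isCompact_Icc (a := (0:ℝ)) (b := 1))).exists_bound_of_continuousOn
      hc.continuousOn
  refine (intervalIntegral.hasDerivAt_integral_of_dominated_loc_of_deriv_le
    (F := fun w t => q t * E (p t * w)) (F' := fun w t => q t * (deriv E (p t * w) * p t))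
    (bound := fun _ => K) (Metric.closedBall_mem_nhds w one_pos) ?_ ?_ ?_ ?_ ?_ ?_).2.differentiableAt
  · refine Eventually.of_forall fun x => ?_
    exact Continuous.aestronglyMeasurable (by fun_prop)
  · exact Continuous.intervalIntegrable (by fun_prop) _ _
  · exact Continuous.aestronglyMeasurable (by fun_prop)
  · refine Eventually.of_forall fun t ht x hx => hK (x, t) ⟨hx, ?_⟩
    rw [Set.uIoc_of_le zero_le_one] at ht
    exact ⟨ht.1.le, ht.2⟩
  · exact intervalIntegrable_const
  · refine Eventually.of_forall fun t ht x hx => ?_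
    have h1 : HasDerivAt (fun x => p t * x) (p t) x := by
      simpa using (hasDerivAt_id x).const_mul (p t)
    exact (((hE _).hasDerivAt.comp x h1)).const_mul (q t)

/-- The reduced Bessel series. -/
noncomputable def gB (n : ℕ) (w : ℂ) : ℂ :=
  ∑' m : ℕ, ((-1) ^ m / ((Nat.factorial m : ℂ) * (Nat.factorial (m + n) : ℂ))) * (w / 4) ^ m

lemma besselJ_eq (n : ℕ) (z : ℂ) : besselJ n z = (z / 2) ^ n * gB n (z ^ 2) := by
  unfold besselJ gB
  rw [← tsum_mul_left]
  congr 1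
  ext m
  have : z ^ 2 / 4 = (z / 2) ^ 2 := by ring
  rw [this, ← pow_mul, pow_add]
  ring

lemma gB_term_norm (n m : ℕ) (w : ℂ) :
    ‖((-1) ^ m / ((Nat.factorial m : ℂ) * (Nat.factorial (m + n) : ℂ))) * (w / 4) ^ m‖
      = (‖w‖ / 4) ^ m / (m.factorial * (m + n).factorial) := by
  simp [norm_pow]
  ring

lemma gB_differentiable (n : ℕ) : Differentiable ℂ (gB n) := by
  intro w
  have hd : DifferentiableOn ℂ (gB n) (Metric.ball 0 (‖w‖ + 1)) := by
    refine Complex.differentiableOn_tsum_of_summable_norm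
      (Real.summable_pow_div_factorial ((‖w‖ + 1) / 4)) ?_ Metric.isOpen_ball ?_
    · intro i
      fun_prop
    · intro m x hx
      rw [gB_term_norm]
      have hx' : ‖x‖ < ‖w‖ + 1 := by simpa using hx
      have h1 : (1:ℝ) ≤ (m + n).factorial := by exact_mod_cast Nat.one_le_iff_ne_zero.2 (Nat.factorial_ne_zero _)
      have h2 : (1:ℝ) ≤ m.factorial := by exact_mod_cast Nat.one_le_iff_ne_zero.2 (Nat.factorial_ne_zero _)
      gcongr
      nlinarith
  exact hd.differentiableAt (Metric.isOpen_ball.mem_nhds (by simp))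

lemma gB_bound (n : ℕ) (w : ℂ) : ‖gB n w‖ ≤ Real.exp √‖w‖ := by
  set r := √‖w‖ / 2 with hr
  have hr0 : 0 ≤ r := by positivity
  have hs : HasSum (fun m : ℕ => Real.exp r * (r ^ m / m.factorial)) (Real.exp √‖w‖) := by
    have h1 : HasSum (fun m : ℕ => r ^ m / m.factorial) (Real.exp r) := by
      rw [Real.exp_eq_exp_ℝ]
      exact NormedSpace.expSeries_div_hasSum_exp r
    have h2 := h1.mul_left (Real.exp r)
    rwa [← Real.exp_add, show r + r = √‖w‖ by rw [hr]; ring] at h2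
  refine tsum_of_norm_bounded hs fun m => ?_
  rw [gB_term_norm]
  have h1 : ‖w‖ / 4 = r * r := by
    have := Real.mul_self_sqrt (norm_nonneg w)
    rw [hr]; linarith
  have h2 : r ^ m / m.factorial ≤ Real.exp r := Real.pow_div_factorial_le_exp r hr0 m
  have h3 : (m.factorial : ℝ) ≤ (m + n).factorial := by
    exact_mod_cast Nat.factorial_le (Nat.le_add_right m n)
  calc (‖w‖ / 4) ^ m / (m.factorial * (m + n).factorial)
      ≤ (‖w‖ / 4) ^ m / (m.factorial * m.factorial) := by gcongr
    _ = (r ^ m / m.factorial) * (r ^ m / m.factorial) := by rw [h1, mul_pow]; field_simp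
    _ ≤ _ := by gcongr

lemma gB_neg (n m : ℕ) (x : ℝ) (hx : 0 ≤ x) : ∃ y : ℝ, gB n (-(x : ℂ)) = y ∧
    (x / 4) ^ m / (m.factorial * (m + n).factorial) ≤ y := by
  have hs : Summable (fun m : ℕ => (x / 4) ^ m / (m.factorial * (m + n).factorial : ℝ)) := by
    refine Summable.of_nonneg_of_le (fun m => by positivity) (fun m => ?_)
      (Real.summable_pow_div_factorial (x / 4))
    have h1 : (1:ℝ) ≤ (m + n).factorial := by exact_mod_cast Nat.one_le_iff_ne_zero.2 (Nat.factorial_ne_zero _)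
    have h2 : (1:ℝ) ≤ m.factorial := by exact_mod_cast Nat.one_le_iff_ne_zero.2 (Nat.factorial_ne_zero _)
    gcongr
    nlinarith
  refine ⟨∑' m : ℕ, (x / 4) ^ m / (m.factorial * (m + n).factorial : ℝ), ?_, ?_⟩
  · rw [Complex.ofReal_tsum]
    unfold gB
    congr 1
    ext m
    push_cast
    rw [show -(x : ℂ) / 4 = (-1) * (x / 4) by ring, mul_pow, div_mul_eq_mul_div, ← mul_assoc,
      ← mul_pow]
    simp
  · exact hs.le_tsum m (fun j _ => by positivity)

/-- The reduced Born function. -/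
noncomputable def HB (n : ℕ) (w : ℂ) : ℂ :=
  ∫ t in (0:ℝ)..1, (((t : ℂ) + 1) * (t : ℂ) ^ (2 * n)) * (gB n ((t : ℂ) ^ 2 * w)) ^ 2

lemma BornB_eq (n : ℕ) (k : ℂ) : BornB n k = (k / 2) ^ (2 * n) * HB n (k ^ 2) := by
  unfold BornB HB
  rw [← intervalIntegral.integral_const_mul]
  congr 1
  ext t
  rw [besselJ_eq, show (k * (t : ℂ)) ^ 2 = (t : ℂ) ^ 2 * k ^ 2 by ring]
  rw [show k * (t : ℂ) / 2 = (k / 2) * t by ring, mul_pow, mul_pow, mul_pow]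
  ring

lemma HB_differentiable (n : ℕ) : Differentiable ℂ (HB n) := by
  exact differentiable_param (fun t => ((t : ℂ) + 1) * (t : ℂ) ^ (2 * n)) (fun t => (t : ℂ) ^ 2)
    (by fun_prop) (by fun_prop) (fun z => gB n z ^ 2) ((gB_differentiable n).pow 2)

lemma HB_bound (n : ℕ) (w : ℂ) : ‖HB n w‖ ≤ 2 * Real.exp (2 * √‖w‖) := by
  have := intervalIntegral.norm_integral_le_of_norm_le_const (a := (0:ℝ)) (b := 1)
    (C := 2 * Real.exp (2 * √‖w‖))
    (f := fun t : ℝ => (((t : ℂ) + 1) * (t : ℂ) ^ (2 * n)) * (gB n ((t : ℂ) ^ 2 * w)) ^ 2) ?_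
  · simpa [HB] using this
  · intro t ht
    rw [Set.uIoc_of_le zero_le_one] at ht
    obtain ⟨ht0, ht1⟩ := ht
    have h1 : ‖(t : ℂ) + 1‖ ≤ 2 := by
      refine (norm_add_le _ _).trans ?_
      rw [Complex.norm_real, Real.norm_of_nonneg ht0.le, norm_one]
      linarith
    have h2 : ‖(t : ℂ) ^ (2 * n)‖ ≤ 1 := by
      rw [norm_pow, Complex.norm_real, Real.norm_of_nonneg ht0.le]
      exact pow_le_one₀ ht0.le ht1
    have h3 : ‖gB n ((t : ℂ) ^ 2 * w)‖ ≤ Real.exp √‖w‖ := by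
      refine (gB_bound n _).trans (Real.exp_le_exp.2 (Real.sqrt_le_sqrt ?_))
      rw [norm_mul, norm_pow, Complex.norm_real, Real.norm_of_nonneg ht0.le]
      have : t ^ 2 ≤ 1 := pow_le_one₀ ht0.le ht1
      nlinarith [norm_nonneg w]
    rw [norm_mul, norm_mul, norm_pow (gB n _)]
    calc _ ≤ 2 * 1 * (Real.exp √‖w‖) ^ 2 := by gcongr
      _ = _ := by rw [← Real.exp_nat_mul]; push_cast; ring

lemma HB_lower (n m : ℕ) : ∃ c : ℝ, 0 < c ∧ ∀ s : ℝ, 0 ≤ s →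
    c * s ^ (2 * m) ≤ ‖HB n (-(s : ℂ))‖ := by
  set d : ℝ := (m.factorial * (m + n).factorial : ℝ) with hd
  have hd0 : 0 < d := by positivity
  refine ⟨(1 / 4 ^ m / d) ^ 2 * (1 / (2 * n + 4 * m + 1)), by positivity, fun s hs => ?_⟩
  have hcont : Continuous (fun t : ℝ => (((t : ℂ) + 1) * (t : ℂ) ^ (2 * n)) *
      (gB n ((t : ℂ) ^ 2 * (-(s : ℂ)))) ^ 2) := by
    have := (gB_differentiable n).continuous
    fun_prop
  refine le_trans ?_ (Complex.re_le_norm _)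
  have hre : (HB n (-(s : ℂ))).re = ∫ t in (0:ℝ)..1, ((((t : ℂ) + 1) * (t : ℂ) ^ (2 * n)) *
      (gB n ((t : ℂ) ^ 2 * (-(s : ℂ)))) ^ 2).re := by
    unfold HB
    exact (Complex.reCLM.intervalIntegral_comp_comm (hcont.intervalIntegrable _ _)).symm
  have hlow : ∫ t in (0:ℝ)..1, ((1 / 4 ^ m / d) ^ 2 * s ^ (2 * m)) * t ^ (2 * n + 4 * m) =
      (1 / 4 ^ m / d) ^ 2 * (1 / (2 * n + 4 * m + 1)) * s ^ (2 * m) := by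
    rw [intervalIntegral.integral_const_mul, integral_pow]
    push_cast
    simp
    ring
  rw [hre, ← hlow]
  refine intervalIntegral.integral_mono_on zero_le_one
    (Continuous.intervalIntegrable (by fun_prop) _ _)
    ((Complex.continuous_re.comp hcont).intervalIntegrable _ _) ?_
  rintro t ⟨ht0, ht1⟩
  obtain ⟨y, hy, hyl⟩ := gB_neg n m (t ^ 2 * s) (by positivity)
  have e1 : (t : ℂ) ^ 2 * (-(s : ℂ)) = -((t ^ 2 * s : ℝ) : ℂ) := by push_cast; ring
  rw [e1, hy]
  have e2 : (((t : ℂ) + 1) * (t : ℂ) ^ (2 * n)) * (y : ℂ) ^ 2 =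
    (((t + 1) * t ^ (2 * n) * y ^ 2 : ℝ) : ℂ) := by push_cast; ring
  rw [e2, Complex.ofReal_re]
  calc ((1 / 4 ^ m / d) ^ 2 * s ^ (2 * m)) * t ^ (2 * n + 4 * m)
      = 1 * t ^ (2 * n) * ((t ^ 2 * s / 4) ^ m / d) ^ 2 := by
        rw [div_pow (t ^ 2 * s), mul_pow]
        field_simp
        ring
    _ ≤ (t + 1) * t ^ (2 * n) * y ^ 2 := by
        gcongr
        linarith

lemma HB_zeros (n : ℕ) : {w : ℂ | HB n w = 0}.Infinite := by
  intro hfin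
  obtain ⟨P, hP⟩ := poly_of_growth hfin.toFinset (HB n) (HB_differentiable n) (by simp)
    ⟨2, 2, by norm_num, HB_bound n⟩
  obtain ⟨K, hK⟩ := poly_bound P
  obtain ⟨c, hc, hl⟩ := HB_lower n (P.natDegree + 1)
  set d := P.natDegree
  set s : ℝ := |K| / c + 1 with hs
  have hs1 : 1 ≤ s := by
    have : 0 ≤ |K| / c := by positivity
    linarith
  have h1 := hl s (by linarith)
  rw [hP] at h1
  have h2 := h1.trans (hK s hs1)
  have h3 : s ^ (d + 1) ≤ s ^ (2 * (d + 1)) := pow_le_pow_right₀ hs1 (by omega)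
  have h4 : c * s = |K| + c := by rw [hs]; field_simp
  have h5 : 0 < s ^ d := by positivity
  have h6 : c * s ^ (d + 1) = (|K| + c) * s ^ d := by rw [← h4]; ring
  have h7 := mul_le_mul_of_nonneg_left h3 hc.le
  have h8 := le_abs_self K
  nlinarith

theorem stmt_0 (n : ℕ) :
    Differentiable ℂ (BornB n) ∧ {k : ℂ | BornB n k = 0}.Infinite := by
  constructor
  · have : BornB n = fun k => (k / 2) ^ (2 * n) * HB n (k ^ 2) := funext (BornB_eq n)
    rw [this]
    have h1 := (HB_differentiable n).comp (differentiable_id.pow 2 : Differentiable ℂ (fun k : ℂ => k ^ 2))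
    have h2 : Differentiable ℂ (fun k : ℂ => (k / 2) ^ (2 * n)) := by fun_prop
    exact h2.mul h1
  · intro hfin
    refine HB_zeros n ((hfin.image (fun k => k ^ 2)).subset ?_)
    intro w hw
    obtain ⟨k, hk'⟩ := IsAlgClosed.exists_pow_nat_eq w (n := 2) two_pos
    have hk := hk'.symm
    refine ⟨k, ?_, hk.symm⟩
    show BornB n k = 0
    rw [BornB_eq, ← hk, show HB n w = 0 from hw, mul_zero]
end

section
/- For every integer n ≥ 0 and every nonzero real number k, one has B_n(k) ≠ 0 and B_n(i k) ≠ 0; that is, B_n has no nonzero real zeros and no nonzero purely imaginary zeros. -/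
open MeasureTheory intervalIntegral Complex

/-- Real power series `∑ s^m / (m! (m+n)!) (k t / 2)^(2m)`. -/
noncomputable def hAux (n : ℕ) (s k t : ℝ) : ℝ :=
  ∑' m : ℕ, (s ^ m / ((Nat.factorial m : ℝ) * (Nat.factorial (m + n) : ℝ))) *
    (k * t / 2) ^ (2 * m)

lemma hAux_cont (n : ℕ) (s k : ℝ) (hs : |s| = 1) :
    ContinuousOn (hAux n s k) (Set.Icc 0 1) := by
  unfold hAux
  refine continuousOn_tsum (u := fun m : ℕ => ((k / 2) ^ 2) ^ m / (Nat.factorial m : ℝ)) ?_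
    (Real.summable_pow_div_factorial _) ?_
  · intro m
    fun_prop
  · intro m t ht
    have h1 : ((k * t / 2) ^ 2) ≤ (k / 2) ^ 2 := by
      have : t ^ 2 ≤ 1 := by nlinarith [ht.1, ht.2]
      nlinarith [sq_nonneg k]
    have hm : (0:ℝ) < Nat.factorial m := by positivity
    have hmn : (1:ℝ) ≤ Nat.factorial (m + n) := by exact_mod_cast Nat.factorial_pos _
    rw [Real.norm_eq_abs, abs_mul, abs_div, abs_pow, hs, one_pow, pow_mul,
      abs_of_nonneg (a := ((k * t / 2) ^ 2) ^ m) (by positivity),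
      abs_of_nonneg (by positivity), div_mul_eq_mul_div, one_mul]
    gcongr
    nlinarith

lemma hAux_zero (n : ℕ) (s k : ℝ) : 0 < hAux n s k 0 := by
  unfold hAux
  rw [tsum_eq_single 0]
  · simp; positivity
  · intro m hm
    simp [hm]

lemma int_pos (n : ℕ) (s k : ℝ) (hs : |s| = 1) (hk : k ≠ 0) :
    0 < ∫ t in (0:ℝ)..1, (t + 1) * ((k * t / 2) ^ n * hAux n s k t) ^ 2 := by
  have hc := hAux_cont n s k hs
  refine intervalIntegral.integral_pos one_pos ?_ ?_ ?_
  · fun_prop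
  · intro t ht
    have := ht.1
    positivity
  · have h0 : ContinuousWithinAt (hAux n s k) (Set.Icc 0 1) 0 := hc 0 (by simp)
    have h1 : ContinuousWithinAt (hAux n s k) (Set.Ioc 0 1) 0 := h0.mono Set.Ioc_subset_Icc_self
    have h2 : ∀ᶠ t in nhdsWithin (0:ℝ) (Set.Ioc 0 1), 0 < hAux n s k t :=
      h1.eventually (lt_mem_nhds (hAux_zero n s k))
    rw [nhdsWithin_Ioc_eq_nhdsGT one_pos] at h2
    obtain ⟨t, ht, hm⟩ := (h2.and (Ioc_mem_nhdsGT (one_pos (α := ℝ)))).exists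
    have := hm.1
    exact ⟨t, ⟨hm.1.le, hm.2⟩, by positivity⟩

lemma bessel_real (n : ℕ) (k t : ℝ) :
    besselJ n ((k : ℂ) * t) = (((k * t / 2) ^ n * hAux n (-1) k t : ℝ) : ℂ) := by
  unfold besselJ hAux
  rw [← tsum_mul_left, Complex.ofReal_tsum]
  refine tsum_congr fun m => ?_
  push_cast
  ring

lemma bessel_imag (n : ℕ) (k t : ℝ) :
    besselJ n (Complex.I * (k : ℂ) * t) =
      Complex.I ^ n * (((k * t / 2) ^ n * hAux n 1 k t : ℝ) : ℂ) := by
  unfold besselJ hAux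
  rw [← tsum_mul_left, Complex.ofReal_tsum, ← tsum_mul_left]
  refine tsum_congr fun m => ?_
  have e : Complex.I * (k : ℂ) * t / 2 = Complex.I * ((k : ℂ) * t / 2) := by ring
  have h : ((-1 : ℂ)) ^ m * (-1) ^ m = 1 := by rw [← mul_pow]; simp
  rw [e, mul_pow, pow_add Complex.I, pow_mul Complex.I, Complex.I_sq]
  push_cast
  rw [one_pow, pow_add]
  linear_combination (Complex.I ^ n * ((k : ℂ) * t / 2) ^ (2 * m) * ((k : ℂ) * t / 2) ^ n /
    ((Nat.factorial m : ℂ) * (Nat.factorial (m + n) : ℂ))) * h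

theorem stmt_1 (n : ℕ) (k : ℝ) (hk : k ≠ 0) :
    BornB n (k : ℂ) ≠ 0 ∧ BornB n (Complex.I * (k : ℂ)) ≠ 0 := by
  constructor
  · have h := int_pos n (-1) k (by simp) hk
    have e : BornB n (k : ℂ) =
        ((∫ t in (0:ℝ)..1, (t + 1) * ((k * t / 2) ^ n * hAux n (-1) k t) ^ 2 : ℝ) : ℂ) := by
      unfold BornB
      rw [← intervalIntegral.integral_ofReal]
      congr 1
      ext t
      rw [bessel_real]
      push_cast
      ring
    rw [e]
    exact_mod_cast h.ne'
  · have h := int_pos n 1 k (by simp) hk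
    have e : BornB n (Complex.I * (k : ℂ)) = (Complex.I ^ n) ^ 2 *
        ((∫ t in (0:ℝ)..1, (t + 1) * ((k * t / 2) ^ n * hAux n 1 k t) ^ 2 : ℝ) : ℂ) := by
      unfold BornB
      rw [← intervalIntegral.integral_ofReal, ← intervalIntegral.integral_const_mul]
      congr 1
      ext t
      rw [bessel_imag]
      push_cast
      ring
    rw [e]
    refine mul_ne_zero (pow_ne_zero _ (pow_ne_zero _ Complex.I_ne_zero)) ?_
    exact_mod_cast h.ne'
end

section
/- For every fixed integer n ≥ 0, the zeros of B_n escape every horizontal strip: for every C > 0 the set {k ∈ ℂ : B_n(k) = 0 and |Im k| ≤ C} is finite. Equivalently, if (k_j) is a sequence of pairwise distinct zeros of B_n, then |Im k_j| → ∞ as j → ∞. -/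
open MeasureTheory intervalIntegral Complex

namespace BornAux

/-- The primitive of an entire function, normalised at zero. -/
noncomputable def prim (g : ℂ → ℂ) (z : ℂ) : ℂ := ∫ t in (0:ℝ)..1, z * g (z * t)

lemma prim_hasDerivAt (g : ℂ → ℂ) (hg : Differentiable ℂ g) (z : ℂ) :
    HasDerivAt (prim g) (g z) z := by
  obtain ⟨F, hF0, hF⟩ := (DifferentiableOn.isExactOn_ball (c := 0) (r := ‖z‖ + 1)
    hg.differentiableOn).with_val_at 0 0
  have key : ∀ w ∈ Metric.ball (0:ℂ) (‖z‖ + 1), prim g w = F w := by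
    intro w hw
    have hd : ∀ t ∈ Set.uIcc (0:ℝ) 1, HasDerivAt (fun t : ℝ => F (w * t)) (w * g (w * t)) t := by
      intro t ht
      rw [Set.uIcc_of_le zero_le_one] at ht
      have hm : w * t ∈ Metric.ball (0:ℂ) (‖z‖ + 1) := by
        rw [mem_ball_zero_iff] at hw ⊢
        rw [norm_mul, Complex.norm_real, Real.norm_of_nonneg ht.1]
        nlinarith [norm_nonneg w, ht.2]
      have h1 : HasDerivAt (fun t : ℝ => w * (t:ℂ)) w t := by
        simpa using (Complex.ofRealCLM.hasDerivAt (x := t)).const_mul w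
      have := (hF _ hm).comp t h1
      rw [mul_comm]
      exact this
    have hgc := hg.continuous
    have := intervalIntegral.integral_eq_sub_of_hasDerivAt hd
      (Continuous.intervalIntegrable (by fun_prop) _ _)
    rw [prim, this]
    simp [hF0]
  have hz : z ∈ Metric.ball (0:ℂ) (‖z‖ + 1) := by simp
  refine (hF z hz).congr_of_eventuallyEq ?_
  filter_upwards [Metric.isOpen_ball.mem_nhds hz] with w hw using key w hw

/-- The entire function with `J_n(z) = (z/2)^n f_n(z^2/4)`. -/
noncomputable def fF (n : ℕ) (w : ℂ) : ℂ :=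
  ∑' m : ℕ, ((-1) ^ m / ((Nat.factorial m : ℂ) * (Nat.factorial (m + n) : ℂ))) * w ^ m

lemma coef_bound (n m : ℕ) :
    ‖((-1) ^ m / ((Nat.factorial m : ℂ) * (Nat.factorial (m + n) : ℂ)))‖
      ≤ 1 / (Nat.factorial m : ℝ) := by
  rw [norm_div, norm_mul, norm_pow, norm_neg, norm_one, one_pow, Complex.norm_natCast,
    Complex.norm_natCast]
  have h1 : (1:ℝ) ≤ (Nat.factorial m : ℝ) := by exact_mod_cast Nat.factorial_pos m
  have h2 : (1:ℝ) ≤ (Nat.factorial (m + n) : ℝ) := by exact_mod_cast Nat.factorial_pos _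
  apply one_div_le_one_div_of_le (by linarith)
  nlinarith

lemma fF_summable (n : ℕ) (w : ℂ) : Summable fun m : ℕ =>
    ((-1) ^ m / ((Nat.factorial m : ℂ) * (Nat.factorial (m + n) : ℂ))) * w ^ m := by
  refine Summable.of_norm_bounded (Real.summable_pow_div_factorial ‖w‖) fun m => ?_
  rw [norm_mul, norm_pow]
  have := mul_le_mul_of_nonneg_right (coef_bound n m) (pow_nonneg (norm_nonneg w) m)
  calc _ ≤ _ := this
    _ = _ := by ring

lemma fF_hasDerivAt (n : ℕ) (w : ℂ) : HasDerivAt (fF n) (- fF (n + 1) w) w := by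
  set c : ℕ → ℂ := fun m => ((-1) ^ m / ((Nat.factorial m : ℂ) * (Nat.factorial (m + n) : ℂ)))
    with hc
  set R := ‖w‖ + 1 with hR
  have hR1 : 0 ≤ R := by positivity
  have hu : Summable (fun m : ℕ => (1 / (Nat.factorial m : ℝ)) * (m * R ^ (m - 1))) := by
    rw [← summable_nat_add_iff 1]
    refine (Real.summable_pow_div_factorial R).congr fun m => ?_
    rw [Nat.factorial_succ]
    have : (Nat.factorial m : ℝ) ≠ 0 := by exact_mod_cast Nat.factorial_ne_zero m
    push_cast
    field_simp
  have h := hasDerivAt_tsum_of_isPreconnected (𝕜 := ℂ) (F := ℂ)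
    (g := fun m z => c m * z ^ m) (g' := fun m z => c m * (m * z ^ (m - 1)))
    (u := fun m : ℕ => (1 / (Nat.factorial m : ℝ)) * (m * R ^ (m - 1)))
    (t := Metric.ball 0 R) (y₀ := w) (y := w) hu Metric.isOpen_ball
    (convex_ball _ _).isPreconnected
    (fun m y _ => (hasDerivAt_pow m y).const_mul (c m))
    (fun m y hy => by
      rw [mem_ball_zero_iff] at hy
      rw [norm_mul, norm_mul, norm_pow, Complex.norm_natCast]
      have := coef_bound n m
      gcongr)
    (by simp [hR]) (fF_summable n w) (by simp [hR])
  have h2 : (∑' m, c m * (m * w ^ (m - 1))) = - fF (n + 1) w := by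
    have hs : Summable fun m => c m * (m * w ^ (m - 1)) := by
      refine Summable.of_norm_bounded hu fun m => ?_
      rw [norm_mul, norm_mul, norm_pow, Complex.norm_natCast]
      have := coef_bound n m
      have h3 : ‖w‖ ≤ R := by simp [hR]
      gcongr
    rw [hs.tsum_eq_zero_add, fF, ← tsum_neg]
    simp only [Nat.cast_zero, zero_mul, mul_zero, zero_add]
    refine tsum_congr fun m => ?_
    simp only [hc, Nat.add_sub_cancel]
    rw [show m + 1 + n = m + (n + 1) by ring, Nat.factorial_succ m]
    have h1 : (Nat.factorial m : ℂ) ≠ 0 := by exact_mod_cast Nat.factorial_ne_zero m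
    have h2 : (Nat.factorial (m + (n + 1)) : ℂ) ≠ 0 := by exact_mod_cast Nat.factorial_ne_zero _
    have h3 : (m : ℂ) + 1 ≠ 0 := by exact_mod_cast Nat.succ_ne_zero m
    push_cast
    field_simp
    ring
  rw [h2] at h
  exact h

lemma fF_rec (n : ℕ) (w : ℂ) : w * fF (n + 2) w = (n + 1) * fF (n + 1) w - fF n w := by
  have e : ((n:ℂ) + 1) * fF (n + 1) w - fF n w = ∑' m : ℕ,
      (((n:ℂ) + 1) * (((-1) ^ m / ((Nat.factorial m : ℂ) * (Nat.factorial (m + (n + 1)) : ℂ))) * w ^ m)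
        - ((-1) ^ m / ((Nat.factorial m : ℂ) * (Nat.factorial (m + n) : ℂ))) * w ^ m) := by
    rw [((fF_summable (n+1) w).mul_left _).tsum_sub (fF_summable n w), tsum_mul_left]
    rfl
  rw [e, (((fF_summable (n+1) w).mul_left _).sub (fF_summable n w)).tsum_eq_zero_add, fF,
    ← tsum_mul_left]
  have h0 : (Nat.factorial n : ℂ) ≠ 0 := by exact_mod_cast Nat.factorial_ne_zero n
  have hn : (n : ℂ) + 1 ≠ 0 := by exact_mod_cast Nat.succ_ne_zero n
  have : (((n:ℂ) + 1) * (((-1) ^ 0 / ((Nat.factorial 0 : ℂ) * (Nat.factorial (0 + (n + 1)) : ℂ))) * w ^ 0)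
        - ((-1) ^ 0 / ((Nat.factorial 0 : ℂ) * (Nat.factorial (0 + n) : ℂ))) * w ^ 0) = 0 := by
    simp only [zero_add, Nat.factorial_succ]
    push_cast
    field_simp
    simp
  rw [this, zero_add]
  refine tsum_congr fun m => ?_
  rw [show m + 1 + (n + 1) = (m + n + 1) + 1 by ring, show m + 1 + n = m + n + 1 by ring,
    show m + (n + 2) = m + n + 1 + 1 by ring, Nat.factorial_succ m, Nat.factorial_succ (m + n + 1)]
  have h1 : (Nat.factorial m : ℂ) ≠ 0 := by exact_mod_cast Nat.factorial_ne_zero m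
  have h2 : (Nat.factorial (m + n + 1) : ℂ) ≠ 0 := by exact_mod_cast Nat.factorial_ne_zero _
  have h3 : (m : ℂ) + 1 ≠ 0 := by exact_mod_cast Nat.succ_ne_zero m
  have h4 : (m : ℂ) + n + 1 + 1 ≠ 0 := by exact_mod_cast Nat.succ_ne_zero (m + n + 1)
  push_cast
  field_simp
  ring

lemma J_eq (n : ℕ) (z : ℂ) : besselJ n z = (z / 2) ^ n * fF n (z ^ 2 / 4) := by
  rw [besselJ, fF, ← tsum_mul_left]
  refine tsum_congr fun m => ?_
  rw [show z ^ 2 / 4 = (z / 2) ^ 2 by ring, ← pow_mul, pow_add]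
  ring

lemma fF_differentiable (n : ℕ) : Differentiable ℂ (fF n) :=
  fun w => (fF_hasDerivAt n w).differentiableAt

lemma J_differentiable (n : ℕ) : Differentiable ℂ (besselJ n) := by
  have : besselJ n = fun z => (z / 2) ^ n * fF n (z ^ 2 / 4) := funext (J_eq n)
  rw [this]
  have := fF_differentiable n
  fun_prop

lemma J_rec (n : ℕ) (z : ℂ) (hz : z ≠ 0) :
    besselJ (n + 2) z = 2 * (n + 1) / z * besselJ (n + 1) z - besselJ n z := by
  have h := fF_rec n (z ^ 2 / 4)
  rw [J_eq, J_eq, J_eq]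
  have : (z / 2) ^ (n + 2) * fF (n + 2) (z ^ 2 / 4)
      = (z / 2) ^ n * (z ^ 2 / 4 * fF (n + 2) (z ^ 2 / 4)) := by ring
  rw [this, h]
  field_simp
  ring

lemma J_deriv1 (n : ℕ) (z : ℂ) (hz : z ≠ 0) :
    HasDerivAt (besselJ n) (n / z * besselJ n z - besselJ (n + 1) z) z := by
  have e : besselJ n = fun z => (z / 2) ^ n * fF n (z ^ 2 / 4) := funext (J_eq n)
  have h1 : HasDerivAt (fun z : ℂ => (z / 2) ^ n) (n * (z / 2) ^ (n - 1) * (1 / 2)) z :=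
    ((hasDerivAt_id z).div_const 2).pow n
  have h2 : HasDerivAt (fun z : ℂ => z ^ 2 / 4) (2 * z / 4) z := by
    simpa using (hasDerivAt_pow 2 z).div_const 4
  have h3 := (fF_hasDerivAt n (z ^ 2 / 4)).comp z h2
  have h4 := h1.mul h3
  have h5 : (n * (z / 2) ^ (n - 1) * (1 / 2)) = n / z * (z / 2) ^ n := by
    rcases n with _ | n
    · simp
    · simp only [Nat.add_sub_cancel, pow_succ]
      field_simp
  rw [e]
  refine HasDerivAt.congr_deriv h4 ?_
  simp only [Function.comp]
  rw [h5, J_eq (n + 1)]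
  ring

lemma J_deriv2 (n : ℕ) (z : ℂ) (hz : z ≠ 0) :
    HasDerivAt (besselJ (n + 1)) (besselJ n z - (n + 1) / z * besselJ (n + 1) z) z := by
  refine (J_deriv1 (n + 1) z hz).congr_deriv ?_
  rw [J_rec n z hz]
  push_cast
  field_simp
  ring

lemma J_im (n : ℕ) (x : ℝ) : (besselJ n x).im = 0 := by
  have : besselJ n x = ((∑' m : ℕ, ((-1) ^ m / ((Nat.factorial m : ℝ) * (Nat.factorial (m + n) : ℝ))) *
    (x / 2) ^ (2 * m + n) : ℝ) : ℂ) := by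
    rw [besselJ, Complex.ofReal_tsum]
    refine tsum_congr fun m => ?_
    push_cast
    rfl
  rw [this, Complex.ofReal_im]

lemma J_neg_sq (n : ℕ) (z : ℂ) : besselJ n (-z) ^ 2 = besselJ n z ^ 2 := by
  rw [J_eq, J_eq, neg_sq, mul_pow, mul_pow, ← pow_mul, ← pow_mul, mul_comm n 2, pow_mul, pow_mul]
  congr 2
  ring

lemma B_neg (n : ℕ) (k : ℂ) : BornB n (-k) = BornB n k := by
  simp only [BornB, neg_mul, J_neg_sq]

lemma B_prim (n : ℕ) (k : ℂ) : k ^ 2 * BornB n k =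
    k * prim (fun z => besselJ n z ^ 2) k + prim (fun z => z * besselJ n z ^ 2) k := by
  have hJ := (J_differentiable n).continuous
  rw [BornB, prim, prim, ← intervalIntegral.integral_const_mul,
    ← intervalIntegral.integral_const_mul, ← intervalIntegral.integral_add
      (Continuous.intervalIntegrable (by fun_prop) _ _)
      (Continuous.intervalIntegrable (by fun_prop) _ _)]
  congr 1
  funext t
  ring

lemma exists_ne (n : ℕ) : ∃ x : ℝ, 1 ≤ x ∧ besselJ n x ≠ 0 := by
  by_contra! h
  have han : AnalyticOnNhd ℂ (besselJ n) Set.univ :=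
    (J_differentiable n).differentiableOn.analyticOnNhd isOpen_univ
  have hfr : ∃ᶠ z in nhdsWithin (2:ℂ) {2}ᶜ, besselJ n z = 0 := by
    have ht : Filter.Tendsto (fun x : ℝ => (x:ℂ)) (nhdsWithin 2 {2}ᶜ) (nhdsWithin (2:ℂ) {2}ᶜ) := by
      refine tendsto_nhdsWithin_iff.2 ⟨?_, ?_⟩
      · have : Filter.Tendsto (fun x : ℝ => (x:ℂ)) (nhds 2) (nhds ((2:ℝ):ℂ)) :=
          Complex.continuous_ofReal.tendsto 2
        exact (by simpa using this : Filter.Tendsto (fun x : ℝ => (x:ℂ)) (nhds 2) (nhds (2:ℂ))).mono_left nhdsWithin_le_nhds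
      · filter_upwards [self_mem_nhdsWithin] with x hx
        intro h'
        apply hx
        have h'' : (x:ℂ) = 2 := h'
        exact_mod_cast h''
    refine ht.frequently (Filter.Eventually.frequently ?_)
    filter_upwards [nhdsWithin_le_nhds (Ioi_mem_nhds (show (1:ℝ) < 2 by norm_num))] with x hx
    exact h x (le_of_lt hx)
  have hz : ∀ z, besselJ n z = 0 := fun z =>
    han.eqOn_zero_of_preconnected_of_frequently_eq_zero isPreconnected_univ (Set.mem_univ 2) hfr
      (Set.mem_univ z)
  have hf : ∀ z : ℂ, z ≠ 0 → fF n (z ^ 2 / 4) = 0 := by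
    intro z hz0
    have := hz z
    rw [J_eq] at this
    exact (mul_eq_zero.1 this).resolve_left (pow_ne_zero _ (div_ne_zero hz0 two_ne_zero))
  have hlim : Filter.Tendsto (fun z : ℂ => fF n (z ^ 2 / 4)) (nhdsWithin 0 {0}ᶜ)
      (nhds (fF n (0 ^ 2 / 4))) := by
    have hc : Continuous (fun z : ℂ => fF n (z ^ 2 / 4)) := by
      have := (fF_differentiable n).continuous
      fun_prop
    exact (hc.tendsto 0).mono_left nhdsWithin_le_nhds
  have hlim2 : Filter.Tendsto (fun z : ℂ => fF n (z ^ 2 / 4)) (nhdsWithin 0 {0}ᶜ) (nhds 0) := by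
    refine tendsto_const_nhds.congr' ?_
    filter_upwards [self_mem_nhdsWithin] with z hz using (hf z hz).symm
  have h0 := tendsto_nhds_unique hlim hlim2
  have h1 : fF n (0 ^ 2 / 4) = 1 / (Nat.factorial n : ℂ) := by
    rw [fF, tsum_eq_single 0]
    · simp
    · intro m hm
      simp [hm]
  rw [h1] at h0
  have : (Nat.factorial n : ℂ) ≠ 0 := by exact_mod_cast Nat.factorial_ne_zero n
  simp [this] at h0

lemma mono_aux (f f' : ℝ → ℝ) (a : ℝ) (h : ∀ x, a ≤ x → HasDerivAt f (f' x) x)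
    (h0 : ∀ x, a ≤ x → 0 ≤ f' x) : ∀ x, a ≤ x → f a ≤ f x := by
  intro x hx
  have hm : MonotoneOn f (Set.Ici a) := by
    refine monotoneOn_of_deriv_nonneg (convex_Ici a)
      (fun y hy => (h y hy).continuousAt.continuousWithinAt)
      (fun y hy => ?_) (fun y hy => ?_)
    · exact (h y (interior_subset hy)).differentiableAt.differentiableWithinAt
    · rw [(h y (interior_subset hy)).deriv]
      exact h0 y (interior_subset hy)
  exact hm Set.self_mem_Ici hx hx

lemma exp_deriv (v x : ℝ) (hx : x ≠ 0) :
    HasDerivAt (fun x : ℝ => Real.exp (v / x)) (Real.exp (v / x) * (-v / x ^ 2)) x := by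
  have h : HasDerivAt (fun x : ℝ => v / x) (-v / x ^ 2) x := by
    have := (hasDerivAt_inv hx).const_mul v
    simp only [div_eq_mul_inv]
    convert! this using 1
    ring
  exact h.exp

lemma real_asymp (N : ℝ) (p q P : ℝ → ℝ)
    (hp : ∀ x, 1 ≤ x → HasDerivAt p (N / x * p x - q x) x)
    (hq : ∀ x, 1 ≤ x → HasDerivAt q (p x - (N + 1) / x * q x) x)
    (hP : ∀ x, 1 ≤ x → HasDerivAt P (p x ^ 2) x)
    (hne : ∃ x, 1 ≤ x ∧ p x ≠ 0) :
    (∃ M, 0 ≤ M ∧ ∀ x, 1 ≤ x → x * p x ^ 2 ≤ M ∧ x * q x ^ 2 ≤ M) ∧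
    ∃ m K x0, 0 < m ∧ ∀ x, x0 ≤ x → m * Real.log x - K ≤ P x := by
  set c : ℝ → ℝ := fun x => (N + 1 / 2) / x * p x - q x with hcdef
  set v : ℝ := N ^ 2 + 1 with hv
  have hv0 : 0 < v := by positivity
  have hc : ∀ x, 1 ≤ x →
      HasDerivAt c (-c x / (2 * x) - p x + (N ^ 2 - 1 / 4) / x ^ 2 * p x) x := by
    intro x hx
    have hx0 : x ≠ 0 := by positivity
    have h1 : HasDerivAt (fun x : ℝ => (N + 1 / 2) / x) (-(N + 1 / 2) / x ^ 2) x := by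
      have := (hasDerivAt_inv hx0).const_mul (N + 1 / 2)
      simp only [div_eq_mul_inv]
      convert! this using 1
      ring
    refine ((h1.mul (hp x hx)).sub (hq x hx)).congr_deriv ?_
    simp only [hcdef]
    field_simp
    ring
  set E : ℝ → ℝ := fun x => x * (p x ^ 2 + c x ^ 2) with hE
  have hp' : ∀ x, 1 ≤ x → HasDerivAt p (c x - p x / (2 * x)) x := by
    intro x hx
    have hx0 : x ≠ 0 := by positivity
    refine (hp x hx).congr_deriv ?_
    simp only [hcdef]
    field_simp
    ring
  have hEd : ∀ x, 1 ≤ x → HasDerivAt E (2 * (N ^ 2 - 1 / 4) * (p x * c x) / x) x := by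
    intro x hx
    have hx0 : x ≠ 0 := by positivity
    refine ((hasDerivAt_id x).mul (((hp' x hx).pow 2).add ((hc x hx).pow 2))).congr_deriv ?_
    simp only [id, Pi.add_apply, Pi.pow_apply]
    field_simp
    ring
  have hpc : ∀ x, 2 * |p x * c x| ≤ p x ^ 2 + c x ^ 2 := by
    intro x
    rw [abs_mul]
    nlinarith [sq_nonneg (|p x| - |c x|), sq_abs (p x), sq_abs (c x)]
  have hE0 : ∀ x, 1 ≤ x → 0 ≤ E x := fun x hx => by simp only [hE]; positivity
  have hEb : ∀ x, 1 ≤ x → |2 * (N ^ 2 - 1 / 4) * (p x * c x) / x| ≤ v / x ^ 2 * E x := by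
    intro x hx
    have hx0 : 0 < x := by positivity
    have e1 : v / x ^ 2 * E x = v * (p x ^ 2 + c x ^ 2) / x := by
      simp only [hE]
      field_simp
    rw [e1, abs_div, abs_of_pos hx0, abs_mul, abs_mul, abs_two]
    have h1 : |N ^ 2 - 1 / 4| ≤ v := by
      rw [abs_le]; constructor <;> nlinarith [sq_nonneg N]
    have h2 := hpc x
    refine div_le_div_of_nonneg_right ?_ hx0.le
    calc 2 * |N ^ 2 - 1 / 4| * |p x * c x| = |N ^ 2 - 1 / 4| * (2 * |p x * c x|) := by ring
      _ ≤ v * (p x ^ 2 + c x ^ 2) := by gcongr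
  -- upper bound of the energy
  obtain ⟨M, hM⟩ : ∃ M, ∀ x, 1 ≤ x → E x ≤ M := by
    refine ⟨E 1 * Real.exp v, fun x hx => ?_⟩
    have := mono_aux (fun x => -(E x * Real.exp (v / x)))
      (fun x => -((2 * (N ^ 2 - 1 / 4) * (p x * c x) / x) * Real.exp (v / x)
        + E x * (Real.exp (v / x) * (-v / x ^ 2)))) 1
      (fun x hx => ((hEd x hx).mul (exp_deriv v x (by positivity))).neg)
      (fun x hx => by
        have h1 := le_of_abs_le (hEb x hx)
        have h2 := Real.exp_pos (v / x)
        have : -((2 * (N ^ 2 - 1 / 4) * (p x * c x) / x) * Real.exp (v / x)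
          + E x * (Real.exp (v / x) * (-v / x ^ 2))) = Real.exp (v / x) *
            (v / x ^ 2 * E x - 2 * (N ^ 2 - 1 / 4) * (p x * c x) / x) := by ring
        rw [this]
        exact mul_nonneg h2.le (by linarith)) x hx
    have h3 : 1 ≤ Real.exp (v / x) := Real.one_le_exp (by positivity)
    have h4 := hE0 x hx
    simp only [div_one] at this
    nlinarith
  have hM0 : 0 ≤ M := (hE0 1 le_rfl).trans (hM 1 le_rfl)
  have hbp : ∀ x, 1 ≤ x → x * p x ^ 2 ≤ M := fun x hx => by
    have h1 := hM x hx
    simp only [hE] at h1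
    nlinarith [sq_nonneg (c x)]
  have hbc : ∀ x, 1 ≤ x → x * c x ^ 2 ≤ M := fun x hx => by
    have h1 := hM x hx
    simp only [hE] at h1
    nlinarith [sq_nonneg (p x)]
  refine ⟨⟨M + 2 * (N + 1 / 2) ^ 2 * M + 2 * M, by positivity, fun x hx => ⟨?_, ?_⟩⟩, ?_⟩
  · have : 0 ≤ 2 * (N + 1 / 2) ^ 2 * M := by positivity
    linarith [hbp x hx]
  · have hx0 : 0 < x := by positivity
    have e : q x = (N + 1 / 2) / x * p x - c x := by simp only [hcdef]; ring
    have h1 : q x ^ 2 ≤ 2 * ((N + 1 / 2) ^ 2 * p x ^ 2) + 2 * c x ^ 2 := by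
      have h2 : ((N + 1 / 2) / x * p x) ^ 2 ≤ (N + 1 / 2) ^ 2 * p x ^ 2 := by
        rw [mul_pow, div_pow]
        gcongr
        exact div_le_self (by positivity) (by nlinarith)
      rw [e]
      nlinarith [sq_nonneg ((N + 1 / 2) / x * p x + c x)]
    have h2 := mul_le_mul_of_nonneg_left h1 hx0.le
    have h3 := mul_le_mul_of_nonneg_left (hbp x hx) (show 0 ≤ 2 * (N + 1 / 2) ^ 2 by positivity)
    nlinarith [hbc x hx]
  -- lower bound
  obtain ⟨x0, hx01, hx0ne⟩ := hne
  obtain ⟨m, hm0, hm⟩ : ∃ m, 0 < m ∧ ∀ x, x0 ≤ x → m ≤ E x := by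
    refine ⟨E x0 * Real.exp (-v / x0), ?_, fun x hx => ?_⟩
    · have : 0 < E x0 := by
        simp only [hE]
        have : 0 < p x0 ^ 2 := by positivity
        positivity
      positivity
    have := mono_aux (fun x => (E x * Real.exp (-v / x)))
      (fun x => ((2 * (N ^ 2 - 1 / 4) * (p x * c x) / x) * Real.exp (-v / x)
        + E x * (Real.exp (-v / x) * (-(-v) / x ^ 2)))) x0
      (fun x hx => ((hEd x (hx01.trans hx)).mul
        (exp_deriv (-v) x (by linarith [hx01.trans hx]))))
      (fun x hx => by
        have h1 := neg_le_of_abs_le (hEb x (hx01.trans hx))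
        have h2 := Real.exp_pos (-v / x)
        have : ((2 * (N ^ 2 - 1 / 4) * (p x * c x) / x) * Real.exp (-v / x)
          + E x * (Real.exp (-v / x) * (-(-v) / x ^ 2))) = Real.exp (-v / x) *
            (v / x ^ 2 * E x + 2 * (N ^ 2 - 1 / 4) * (p x * c x) / x) := by ring
        rw [this]
        exact mul_nonneg h2.le (by linarith)) x hx
    have hx1 := hx01.trans hx
    have h3 : Real.exp (-v / x) ≤ 1 := by
      rw [Real.exp_le_one_iff]
      exact div_nonpos_of_nonpos_of_nonneg (by linarith) (by linarith)
    have h4 := hE0 x hx1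
    nlinarith
  set K1 := (1 + v) * M with hK1
  have hK10 : 0 ≤ K1 := by positivity
  have hmono := mono_aux (fun x => 2 * P x + p x * c x - m * Real.log x - K1 * x⁻¹)
    (fun x => 2 * p x ^ 2 + ((c x - p x / (2 * x)) * c x
      + p x * (-c x / (2 * x) - p x + (N ^ 2 - 1 / 4) / x ^ 2 * p x)) - m * x⁻¹
        - K1 * (-(x ^ 2)⁻¹)) x0
    (fun x hx => by
      have hx1 := hx01.trans hx
      have hxn : x ≠ 0 := by positivity
      exact ((((hP x hx1).const_mul 2).add ((hp' x hx1).mul (hc x hx1))).sub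
        ((Real.hasDerivAt_log hxn).const_mul m)).sub ((hasDerivAt_inv hxn).const_mul K1))
    (fun x hx => by
      have hx1 := hx01.trans hx
      have hxn : 0 < x := by positivity
      have e : 2 * p x ^ 2 + ((c x - p x / (2 * x)) * c x
        + p x * (-c x / (2 * x) - p x + (N ^ 2 - 1 / 4) / x ^ 2 * p x)) - m * x⁻¹
        - K1 * (-(x ^ 2)⁻¹) = (E x - m) / x +
          (K1 - x * (p x * c x) + (N ^ 2 - 1 / 4) * p x ^ 2) / x ^ 2 := by
        simp only [hE]
        field_simp
        ring
      rw [e]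
      have h1 := hm x hx
      have h2 := hM x hx1
      have h3 := hbp x hx1
      have h4 : p x ^ 2 ≤ M := le_trans (by nlinarith [sq_nonneg (p x)]) h3
      have h5 : x * (p x * c x) ≤ M := by
        have := hpc x
        have h6 := le_abs_self (p x * c x)
        have h7 : p x * c x ≤ p x ^ 2 + c x ^ 2 := by linarith [abs_nonneg (p x * c x)]
        exact (mul_le_mul_of_nonneg_left h7 hxn.le).trans h2
      have h6 : -(v * M) ≤ (N ^ 2 - 1 / 4) * p x ^ 2 := by
        have h8 : -v ≤ N ^ 2 - 1 / 4 := by nlinarith [sq_nonneg N]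
        have h9 := mul_le_mul_of_nonneg_left h4 hv0.le
        nlinarith [mul_le_mul_of_nonneg_right h8 (sq_nonneg (p x))]
      refine add_nonneg (div_nonneg (by linarith) hxn.le) (div_nonneg ?_ (by positivity))
      rw [hK1]
      linarith)
  refine ⟨m / 2, -(2 * P x0 + p x0 * c x0 - m * Real.log x0 - K1 * x0⁻¹) / 2 + M / 2, x0,
    by positivity, fun x hx => ?_⟩
  have hx1 := hx01.trans hx
  have hxn : 0 < x := by positivity
  have h1 := hmono x hx
  have h5 : p x * c x ≤ M := by
    have := hpc x
    have h2 := hM x hx1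
    have h6 := le_abs_self (p x * c x)
    have h7 : p x * c x ≤ p x ^ 2 + c x ^ 2 := by linarith [abs_nonneg (p x * c x)]
    have h8 : p x ^ 2 + c x ^ 2 ≤ E x := by
      simp only [hE]
      nlinarith [sq_nonneg (p x), sq_nonneg (c x)]
    linarith
  have h6 : 0 ≤ K1 * x⁻¹ := by positivity
  linarith

lemma strip_bound (n : ℕ) (C M : ℝ) (hC : 0 < C)
    (hM : ∀ x : ℝ, 1 ≤ x → x * (besselJ n x).re ^ 2 ≤ M ∧ x * (besselJ (n + 1) x).re ^ 2 ≤ M) :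
    ∃ M', 0 ≤ M' ∧ ∀ z : ℂ, 1 ≤ z.re → |z.im| ≤ C → z.re * ‖besselJ n z‖ ^ 2 ≤ M' := by
  have hM0 : 0 ≤ M := le_trans (by positivity) (hM 1 le_rfl).1
  refine ⟨M * Real.exp ((n + 2) * C) ^ 2, by positivity, fun z hz hzC => ?_⟩
  set x := z.re with hx
  have hx0 : 0 < x := by linarith
  have nrm : ∀ j : ℕ, ‖besselJ j x‖ ^ 2 = (besselJ j x).re ^ 2 := by
    intro j
    rw [Complex.sq_norm, Complex.normSq_apply, J_im]
    ring
  set γ : ℝ → ℂ := fun y => x + y * (z.im * I) with hγ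
  have hγre : ∀ y, (γ y).re = x := by intro y; simp [hγ]
  have hγ1 : ∀ y, 1 ≤ ‖γ y‖ := fun y => by
    have := Complex.abs_re_le_norm (γ y)
    rw [hγre, abs_of_pos hx0] at this
    linarith
  have hγ0 : ∀ y, γ y ≠ 0 := fun y h => by
    have := hγ1 y
    rw [h, norm_zero] at this
    linarith
  have hγd : ∀ y, HasDerivAt γ (z.im * I) y := by
    intro y
    have := ((Complex.ofRealCLM.hasDerivAt (x := y)).mul_const ((z.im:ℂ) * I)).const_add (x:ℂ)
    refine HasDerivAt.congr_deriv this ?_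
    simp
  set f : ℝ → ℂ × ℂ := fun y => (besselJ n (γ y), besselJ (n + 1) (γ y)) with hf
  set f' : ℝ → ℂ × ℂ := fun y =>
    ((n / γ y * besselJ n (γ y) - besselJ (n + 1) (γ y)) * (z.im * I),
     (besselJ n (γ y) - (n + 1) / γ y * besselJ (n + 1) (γ y)) * (z.im * I)) with hf'
  have hfd : ∀ y, HasDerivAt f (f' y) y := fun y =>
    HasDerivAt.prodMk ((J_deriv1 n _ (hγ0 y)).comp y (hγd y))
      ((J_deriv2 n _ (hγ0 y)).comp y (hγd y))
  have hbd : ∀ y, ‖f' y‖ ≤ ((n + 2) * C) * ‖f y‖ + 0 := by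
    intro y
    have h1 : ‖besselJ n (γ y)‖ ≤ ‖f y‖ := norm_fst_le (f y)
    have h2 : ‖besselJ (n + 1) (γ y)‖ ≤ ‖f y‖ := norm_snd_le (f y)
    have h3 : ‖(z.im:ℂ) * I‖ ≤ C := by simpa using hzC
    have h4 : ‖(n:ℂ) / γ y‖ ≤ n := by
      rw [norm_div, Complex.norm_natCast]
      exact div_le_self (by positivity) (hγ1 y)
    have h5 : ‖((n:ℂ) + 1) / γ y‖ ≤ n + 1 := by
      rw [norm_div]
      have : ‖(n:ℂ) + 1‖ = n + 1 := by
        have := Complex.norm_natCast (n + 1)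
        push_cast at this
        exact this
      rw [this]
      exact div_le_self (by positivity) (hγ1 y)
    have hfn := norm_nonneg (f y)
    rw [add_zero, Prod.norm_def, max_le_iff]
    constructor
    · simp only [hf', norm_mul (_ - _)]
      have h6 : ‖n / γ y * besselJ n (γ y) - besselJ (n + 1) (γ y)‖ ≤ (n + 2) * ‖f y‖ := by
        refine (norm_sub_le _ _).trans ?_
        rw [norm_mul]
        have := mul_le_mul h4 h1 (norm_nonneg _) (by positivity)
        linarith
      have := mul_le_mul h6 h3 (norm_nonneg _) (by positivity)
      linarith
    · simp only [hf', norm_mul (_ - _)]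
      have h6 : ‖besselJ n (γ y) - (n + 1) / γ y * besselJ (n + 1) (γ y)‖ ≤ (n + 2) * ‖f y‖ := by
        refine (norm_sub_le _ _).trans ?_
        rw [norm_mul]
        have := mul_le_mul h5 h2 (norm_nonneg _) (by positivity)
        linarith
      have := mul_le_mul h6 h3 (norm_nonneg _) (by positivity)
      linarith
  have hg := norm_le_gronwallBound_of_norm_deriv_right_le (f := f) (f' := f') (a := 0) (b := 1)
    (δ := ‖f 0‖) (fun y _ => (hfd y).continuousAt.continuousWithinAt)
    (fun y _ => (hfd y).hasDerivWithinAt) le_rfl (fun y _ => hbd y) 1 (by simp)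
  rw [gronwallBound_ε0, sub_zero, mul_one] at hg
  have hf0 : x * ‖f 0‖ ^ 2 ≤ M := by
    have e0 : γ 0 = x := by simp [hγ]
    rw [Prod.norm_def]
    simp only [hf, e0]
    rcases max_choice ‖besselJ n x‖ ‖besselJ (n + 1) x‖ with h | h
    · rw [h, nrm]; exact (hM x hz).1
    · rw [h, nrm]; exact (hM x hz).2
  have e1 : γ 1 = z := by
    simp only [hγ, Complex.ofReal_one, one_mul]
    exact Complex.re_add_im z
  have h1 : ‖besselJ n z‖ ≤ ‖f 0‖ * Real.exp ((n + 2) * C) := by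
    refine le_trans ?_ hg
    have := norm_fst_le (f 1)
    simpa only [hf, e1] using this
  calc x * ‖besselJ n z‖ ^ 2 ≤ x * (‖f 0‖ * Real.exp ((n + 2) * C)) ^ 2 := by gcongr
    _ = (x * ‖f 0‖ ^ 2) * Real.exp ((n + 2) * C) ^ 2 := by ring
    _ ≤ _ := by gcongr

/-- The entire function `k ^ 2 * B_n(k)`. -/
noncomputable def DD (n : ℕ) (k : ℂ) : ℂ :=
  k * prim (fun z => besselJ n z ^ 2) k + prim (fun z => z * besselJ n z ^ 2) k

lemma J2_diff (n : ℕ) : Differentiable ℂ (fun z => besselJ n z ^ 2) := (J_differentiable n).pow 2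

lemma zJ2_diff (n : ℕ) : Differentiable ℂ (fun z => z * besselJ n z ^ 2) :=
  differentiable_id.mul (J2_diff n)

lemma DD_diff (n : ℕ) : Differentiable ℂ (DD n) := by
  have h1 : Differentiable ℂ (prim (fun z => besselJ n z ^ 2)) :=
    fun z => (prim_hasDerivAt _ (J2_diff n) z).differentiableAt
  have h2 : Differentiable ℂ (prim (fun z => z * besselJ n z ^ 2)) :=
    fun z => (prim_hasDerivAt _ (zJ2_diff n) z).differentiableAt
  exact (differentiable_id.mul h1).add h2

lemma DD_ne (n : ℕ) (C : ℝ) (hC : 0 < C) :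
    ∃ X : ℝ, ∀ k : ℂ, |k.im| ≤ C → X ≤ k.re → DD n k ≠ 0 := by
  have hne : ∃ x : ℝ, 1 ≤ x ∧ (besselJ n x).re ≠ 0 := by
    obtain ⟨x, hx, h⟩ := exists_ne n
    refine ⟨x, hx, fun h' => h (Complex.ext ?_ ?_)⟩
    · simpa using h'
    · simpa using J_im n x
  have hx0 : ∀ x : ℝ, 1 ≤ x → (x:ℂ) ≠ 0 := fun x hx => by
    have : x ≠ 0 := by positivity
    exact_mod_cast this
  obtain ⟨⟨M, -, hM⟩, m, K, x0, hm, hlow⟩ := real_asymp (n:ℝ) (fun x => (besselJ n x).re)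
    (fun x => (besselJ (n + 1) x).re) (fun x => (prim (fun z => besselJ n z ^ 2) x).re)
    (fun x hx => (J_deriv1 n x (hx0 x hx)).real_of_complex.congr_deriv (by
      have : (n:ℂ) / (x:ℂ) = ((n / x : ℝ) : ℂ) := by push_cast; rfl
      rw [this, Complex.sub_re, Complex.re_ofReal_mul]))
    (fun x hx => (J_deriv2 n x (hx0 x hx)).real_of_complex.congr_deriv (by
      have : ((n:ℂ) + 1) / (x:ℂ) = (((n + 1) / x : ℝ) : ℂ) := by push_cast; rfl
      rw [this, Complex.sub_re, Complex.re_ofReal_mul]))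
    (fun x hx => (prim_hasDerivAt _ (J2_diff n) (x:ℂ)).real_of_complex.congr_deriv (by
      simp [pow_two, J_im]))
    hne
  obtain ⟨M', hM'0, hM'⟩ := strip_bound n C M hC hM
  obtain ⟨B0, hB0⟩ := (isCompact_Icc.reProdIm isCompact_Icc :
    IsCompact (Set.Icc (0:ℝ) 1 ×ℂ Set.Icc (-C) C)).exists_bound_of_continuousOn
      (f := fun z => z * besselJ n z ^ 2) (zJ2_diff n).continuous.continuousOn
  set B := max B0 ((1 + C) * M') with hB
  have hBb : ∀ z : ℂ, 0 ≤ z.re → |z.im| ≤ C → ‖z * besselJ n z ^ 2‖ ≤ B := by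
    intro z hz hzC
    rcases le_total z.re 1 with h1 | h1
    · refine (hB0 z ?_).trans (le_max_left _ _)
      rw [Complex.mem_reProdIm]
      exact ⟨⟨hz, h1⟩, abs_le.1 hzC⟩
    · refine le_trans ?_ (le_max_right _ _)
      rw [norm_mul, norm_pow]
      have h2 : ‖z‖ ≤ (1 + C) * z.re := by
        have := Complex.norm_le_abs_re_add_abs_im z
        rw [abs_of_nonneg hz] at this
        nlinarith
      calc ‖z‖ * ‖besselJ n z‖ ^ 2 ≤ ((1 + C) * z.re) * ‖besselJ n z‖ ^ 2 := by gcongr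
        _ = (1 + C) * (z.re * ‖besselJ n z‖ ^ 2) := by ring
        _ ≤ _ := by
          have := hM' z h1 hzC
          gcongr
  refine ⟨max (max 1 x0) (Real.exp ((K + M' * C + B + 1) / m)), fun k hkC hk h0 => ?_⟩
  have hk1 : 1 ≤ k.re := le_trans (le_trans (le_max_left _ _) (le_max_left _ _)) hk
  have hk2 : x0 ≤ k.re := le_trans (le_trans (le_max_right _ _) (le_max_left _ _)) hk
  have hk3 : Real.exp ((K + M' * C + B + 1) / m) ≤ k.re := le_trans (le_max_right _ _) hk
  have hlog : K + M' * C + B + 1 ≤ m * Real.log k.re := by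
    have := Real.log_le_log (Real.exp_pos _) hk3
    rw [Real.log_exp, div_le_iff₀ hm] at this
    linarith
  have hknorm : 0 < ‖k‖ := by
    have := Complex.abs_re_le_norm k
    rw [abs_of_nonneg (by linarith)] at this
    linarith
  -- second primitive
  have hp2 : ‖prim (fun z => z * besselJ n z ^ 2) k‖ ≤ ‖k‖ * B := by
    have := intervalIntegral.norm_integral_le_of_norm_le_const (a := (0:ℝ)) (b := 1)
      (C := ‖k‖ * B) (f := fun t : ℝ => k * (fun z => z * besselJ n z ^ 2) (k * t)) (by
        intro t ht
        rw [Set.uIoc_of_le zero_le_one] at ht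
        rw [norm_mul]
        refine mul_le_mul_of_nonneg_left (hBb _ ?_ ?_) hknorm.le
        · rw [Complex.re_mul_ofReal]
          exact mul_nonneg (by linarith) ht.1.le
        · rw [Complex.im_mul_ofReal, abs_mul, abs_of_pos ht.1]
          nlinarith [abs_nonneg k.im, ht.2])
    simpa [prim] using this
  have hp1 : ‖prim (fun z => besselJ n z ^ 2) k - prim (fun z => besselJ n z ^ 2) k.re‖
      ≤ M' * C := by
    have hconv : Convex ℝ (Set.Ici (1:ℝ) ×ℂ Set.Icc (-C) C) :=
      ((convex_Ici (1:ℝ)).linear_preimage Complex.reLm).inter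
        ((convex_Icc (-C) C).linear_preimage Complex.imLm)
    have := hconv.norm_image_sub_le_of_norm_hasDerivWithin_le
      (f := prim (fun z => besselJ n z ^ 2)) (f' := fun z => besselJ n z ^ 2) (C := M')
      (x := (k.re : ℂ)) (y := k)
      (fun z _ => (prim_hasDerivAt _ (J2_diff n) z).hasDerivWithinAt)
      (fun z hz => by
        rw [Complex.mem_reProdIm] at hz
        have h1 : 1 ≤ z.re := hz.1
        have h2 := hM' z h1 (abs_le.2 hz.2)
        rw [norm_pow]
        nlinarith [sq_nonneg ‖besselJ n z‖])
      (by
        rw [Complex.mem_reProdIm]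
        refine ⟨by simpa using hk1, ?_⟩
        simp [hC.le])
      (by
        rw [Complex.mem_reProdIm]
        exact ⟨hk1, abs_le.1 hkC⟩)
    refine this.trans ?_
    have e : k - k.re = k.im * I := by
      rw [sub_eq_iff_eq_add, add_comm]
      exact (Complex.re_add_im k).symm
    have : ‖k - k.re‖ ≤ C := by
      rw [e]
      simpa using hkC
    gcongr
  have hlow1 := hlow k.re hk2
  have hre := Complex.re_le_norm (prim (fun z => besselJ n z ^ 2) k.re)
  have htri := norm_sub_norm_le (prim (fun z => besselJ n z ^ 2) (k.re : ℂ))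
    (prim (fun z => besselJ n z ^ 2) k)
  rw [norm_sub_rev] at htri
  have hge : B + 1 ≤ ‖prim (fun z => besselJ n z ^ 2) k‖ := by linarith
  have heq : ‖k‖ * ‖prim (fun z => besselJ n z ^ 2) k‖
      = ‖prim (fun z => z * besselJ n z ^ 2) k‖ := by
    rw [← norm_mul, eq_neg_of_add_eq_zero_left h0, norm_neg]
  nlinarith

end BornAux

theorem stmt_4 (n : ℕ) (C : ℝ) (hC : 0 < C) :
    {k : ℂ | BornB n k = 0 ∧ |k.im| ≤ C}.Finite := by
  obtain ⟨X, hX⟩ := BornAux.DD_ne n C hC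
  have hD : ∀ k, BornB n k = 0 → BornAux.DD n k = 0 := fun k hk => by
    have := BornAux.B_prim n k
    rw [hk, mul_zero] at this
    exact this.symm
  have hcpt : IsCompact (Set.Icc (-X) X ×ℂ Set.Icc (-C) C) :=
    isCompact_Icc.reProdIm isCompact_Icc
  by_contra hinf
  obtain ⟨z, -, hz⟩ := Set.Infinite.exists_accPt_of_subset_isCompact hinf hcpt (by
    rintro k ⟨hk, hkC⟩
    rw [Complex.mem_reProdIm]
    refine ⟨⟨?_, ?_⟩, abs_le.1 hkC⟩
    · by_contra! h
      refine hX (-k) (by simpa using hkC) (by rw [Complex.neg_re]; linarith) (hD _ ?_)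
      rw [BornAux.B_neg, hk]
    · by_contra! h
      exact hX k hkC h.le (hD k hk))
  rw [accPt_iff_frequently_nhdsNE] at hz
  have han : AnalyticOnNhd ℂ (BornAux.DD n) Set.univ :=
    (BornAux.DD_diff n).differentiableOn.analyticOnNhd isOpen_univ
  have h0 := han.eqOn_zero_of_preconnected_of_frequently_eq_zero isPreconnected_univ
    (Set.mem_univ z) (hz.mono fun k hk => hD k hk.1) (Set.mem_univ (X:ℂ))
  exact hX X (by simp [hC.le]) (by simp) h0
end

section
/- The set {k ∈ ℂ : B_n(k) = 0 for some integer n ≥ 0} is discrete in ℂ, i.e. it has no accumulation point in ℂ. -/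
open MeasureTheory intervalIntegral Complex

lemma besselJ_differentiable (n : ℕ) : Differentiable ℂ (besselJ n) := by
  intro z
  set R : ℝ := ‖z‖ + 1 with hR
  have hs : Summable (fun m : ℕ => (R / 2) ^ n * (((R / 2) ^ 2) ^ m / (Nat.factorial m : ℝ))) :=
    (Real.summable_pow_div_factorial ((R / 2) ^ 2)).mul_left _
  have h : DifferentiableOn ℂ (besselJ n) (Metric.ball 0 R) := by
    unfold besselJ
    refine differentiableOn_tsum_of_summable_norm hs (fun m => ?_) Metric.isOpen_ball ?_
    · fun_prop
    · intro m w hw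
      have hw' : ‖w‖ ≤ R := by simpa using (Metric.mem_ball.1 hw).le
      have h1 : (1 : ℝ) ≤ (Nat.factorial (m + n) : ℝ) := by
        exact_mod_cast Nat.succ_le_of_lt (Nat.factorial_pos _)
      have h2 : (0 : ℝ) < (Nat.factorial m : ℝ) := by exact_mod_cast Nat.factorial_pos _
      have h3 : (‖w‖ / 2) ^ (2 * m + n) ≤ (R / 2) ^ (2 * m + n) := by gcongr
      simp only [norm_mul, norm_div, norm_pow, norm_neg, norm_one, one_pow, Complex.norm_natCast,
        Complex.norm_ofNat]
      calc 1 / ((Nat.factorial m : ℝ) * (Nat.factorial (m + n) : ℝ)) * (‖w‖ / 2) ^ (2 * m + n)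
          ≤ 1 / ((Nat.factorial m : ℝ) * 1) * (R / 2) ^ (2 * m + n) := by gcongr
        _ = (R / 2) ^ n * (((R / 2) ^ 2) ^ m / (Nat.factorial m : ℝ)) := by
          rw [pow_add, pow_mul]; field_simp
  exact h.differentiableAt (Metric.isOpen_ball.mem_nhds (by simp [hR]))

lemma besselJ_small (n : ℕ) (z : ℂ) (hz : ‖z‖ ^ 2 ≤ n + 1) :
    ∃ g : ℂ, besselJ n z = (z / 2) ^ n / (Nat.factorial n : ℂ) * g ∧ ‖g - 1‖ ≤ 1 / 3 := by
  set a : ℕ → ℂ := fun m => (-1) ^ m * (Nat.factorial n : ℂ) /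
    ((Nat.factorial m : ℂ) * (Nat.factorial (m + n) : ℂ)) * (z / 2) ^ (2 * m) with ha
  have hb : ∀ m, ‖a m‖ ≤ (1 / 4 : ℝ) ^ m := by
    intro m
    have h1 : (1 : ℝ) ≤ (Nat.factorial m : ℝ) := by
      exact_mod_cast Nat.succ_le_of_lt (Nat.factorial_pos _)
    have h2 : (Nat.factorial n : ℝ) * ((n : ℝ) + 1) ^ m ≤ (Nat.factorial (m + n) : ℝ) := by
      rw [add_comm m n]
      exact_mod_cast Nat.factorial_mul_pow_le_factorial
    have h0 : (0 : ℝ) < (Nat.factorial (m + n) : ℝ) := by exact_mod_cast Nat.factorial_pos _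
    simp only [ha, norm_mul, norm_div, norm_pow, norm_neg, norm_one, one_pow,
      Complex.norm_natCast, Complex.norm_ofNat, one_mul]
    have h3 : (‖z‖ / 2) ^ (2 * m) ≤ (((n : ℝ) + 1) / 4) ^ m := by
      rw [pow_mul]
      gcongr
      nlinarith
    calc (Nat.factorial n : ℝ) / ((Nat.factorial m : ℝ) * (Nat.factorial (m + n) : ℝ))
          * (‖z‖ / 2) ^ (2 * m)
        ≤ (Nat.factorial n : ℝ) / (1 * (Nat.factorial (m + n) : ℝ))
          * (((n : ℝ) + 1) / 4) ^ m := by gcongr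
      _ = ((Nat.factorial n : ℝ) * ((n : ℝ) + 1) ^ m) / (Nat.factorial (m + n) : ℝ)
          * (1 / 4) ^ m := by rw [div_pow, div_pow, one_pow]; field_simp
      _ ≤ 1 * (1 / 4) ^ m := by
          gcongr
          exact (div_le_one h0).2 h2
      _ = _ := one_mul _
  have hg : Summable (fun m : ℕ => (1 / 4 : ℝ) ^ m) :=
    summable_geometric_of_lt_one (by norm_num) (by norm_num)
  have hsum : Summable a := Summable.of_norm_bounded hg hb
  refine ⟨∑' m, a m, ?_, ?_⟩
  · rw [← tsum_mul_left]
    unfold besselJ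
    congr 1
    ext m
    have hn : (Nat.factorial n : ℂ) ≠ 0 := by exact_mod_cast Nat.factorial_ne_zero n
    simp only [ha]
    rw [pow_add]
    field_simp
  · have h0 : a 0 = 1 := by
      have hn : (Nat.factorial n : ℂ) ≠ 0 := by exact_mod_cast Nat.factorial_ne_zero n
      simp [ha, hn]
    rw [hsum.tsum_eq_zero_add, h0, add_sub_cancel_left]
    have hg' : HasSum (fun m : ℕ => (1 / 4 : ℝ) * (1 / 4 : ℝ) ^ m) (1 / 3) := by
      have := (hasSum_geometric_of_lt_one (r := (1 / 4 : ℝ)) (by norm_num) (by norm_num)).mul_left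
        (1 / 4 : ℝ)
      have e : (1 / 4 : ℝ) * (1 - 1 / 4)⁻¹ = 1 / 3 := by norm_num
      rw [e] at this
      exact this
    refine tsum_of_norm_bounded hg' fun m => ?_
    rw [← pow_succ']
    exact hb (m + 1)

lemma BornB_ne_zero (n : ℕ) (k : ℂ) (hk0 : k ≠ 0) (hk : ‖k‖ ^ 2 ≤ n + 1) : BornB n k ≠ 0 := by
  intro hB
  set c : ℂ := ((k / 2) ^ n / (Nat.factorial n : ℂ)) ^ 2 with hc
  have hn : (Nat.factorial n : ℂ) ≠ 0 := by exact_mod_cast Nat.factorial_ne_zero n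
  have hc0 : c ≠ 0 := by
    apply pow_ne_zero
    apply div_ne_zero _ hn
    apply pow_ne_zero
    exact div_ne_zero hk0 two_ne_zero
  have hJ : Continuous (besselJ n) := (besselJ_differentiable n).continuous
  have hcont : Continuous (fun t : ℝ => c⁻¹ * (((t : ℂ) + 1) * (besselJ n (k * t)) ^ 2)) := by
    fun_prop
  have hint : ∫ t in (0:ℝ)..1, c⁻¹ * (((t : ℂ) + 1) * (besselJ n (k * t)) ^ 2) = 0 := by
    rw [intervalIntegral.integral_const_mul]
    unfold BornB at hB
    rw [hB, mul_zero]
  have hre := Complex.reCLM.intervalIntegral_comp_comm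
    (hcont.intervalIntegrable (μ := volume) 0 1)
  rw [hint] at hre
  simp only [Complex.reCLM_apply, Complex.zero_re] at hre
  have hpos : 0 < ∫ t in (0:ℝ)..1, (c⁻¹ * (((t : ℂ) + 1) * (besselJ n (k * t)) ^ 2)).re := by
    apply intervalIntegral_pos_of_pos_on _ _ zero_lt_one
    · exact (Complex.continuous_re.comp hcont).intervalIntegrable _ _
    · intro t ht
      obtain ⟨ht0, ht1⟩ := ht
      obtain ⟨g, hg, hg1⟩ := besselJ_small n (k * t) (by
        rw [norm_mul, Complex.norm_real, Real.norm_eq_abs, abs_of_pos ht0, mul_pow]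
        have : t ^ 2 ≤ 1 := by nlinarith
        nlinarith [sq_nonneg ‖k‖])
      have e : c⁻¹ * (((t : ℂ) + 1) * (besselJ n (k * t)) ^ 2)
          = (((t + 1) * t ^ (2 * n) : ℝ) : ℂ) * g ^ 2 := by
        have : (besselJ n (k * t)) ^ 2 = c * ((t : ℂ) ^ (2 * n) * g ^ 2) := by
          rw [hg, hc]
          have : k * (t : ℂ) / 2 = k / 2 * t := by ring
          rw [this, mul_pow]
          ring
        rw [this]
        push_cast
        field_simp
      rw [e, Complex.re_ofReal_mul]
      have hr := (Complex.abs_re_le_norm (g - 1)).trans hg1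
      have hi := (Complex.abs_im_le_norm (g - 1)).trans hg1
      simp only [Complex.sub_re, Complex.sub_im, Complex.one_re, Complex.one_im, sub_zero] at hr hi
      rw [abs_le] at hr hi
      have : 0 < (g ^ 2).re := by
        rw [sq, Complex.mul_re]
        nlinarith
      positivity
  rw [hre] at hpos
  exact lt_irrefl _ hpos

lemma BornB_differentiable (n : ℕ) : Differentiable ℂ (BornB n) := by
  intro k
  have hJd := besselJ_differentiable n
  have hJ : Continuous (besselJ n) := hJd.continuous
  have hJ' : Continuous (deriv (besselJ n)) :=
    (hJd.contDiff (n := 1)).continuous_deriv le_rfl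
  set F : ℂ → ℝ → ℂ := fun x t => ((t : ℂ) + 1) * (besselJ n (x * t)) ^ 2 with hF
  set F' : ℂ → ℝ → ℂ := fun x t =>
    ((t : ℂ) + 1) * (2 * besselJ n (x * t) * (deriv (besselJ n) (x * t) * t)) with hF'
  have hF'c : Continuous (fun p : ℂ × ℝ => F' p.1 p.2) := by
    simp only [hF']
    fun_prop
  have hFc : ∀ x, Continuous (F x) := by
    intro x
    simp only [hF]
    fun_prop
  obtain ⟨C, hC⟩ := ((isCompact_closedBall k 1).prod (isCompact_Icc (a := (0:ℝ)) (b := 1))).exists_bound_of_continuousOn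
    hF'c.continuousOn
  have hF'k : Continuous (F' k) := hF'c.comp (Continuous.prodMk_right k)
  have key := intervalIntegral.hasDerivAt_integral_of_dominated_loc_of_deriv_le
    (μ := volume) (a := 0) (b := 1) (F := F) (F' := F') (x₀ := k) (bound := fun _ => C)
    (Metric.closedBall_mem_nhds k one_pos)
    (Filter.Eventually.of_forall fun x => (hFc x).aestronglyMeasurable)
    ((hFc k).intervalIntegrable _ _) hF'k.aestronglyMeasurable
    (Filter.Eventually.of_forall fun t ht x hx => by
      rw [Set.uIoc_of_le zero_le_one] at ht
      exact hC (x, t) ⟨hx, ht.1.le, ht.2⟩)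
    (by simp)
    (Filter.Eventually.of_forall fun t ht x hx => by
      have h1 : HasDerivAt (fun x : ℂ => x * (t : ℂ)) (t : ℂ) x := by
        simpa using (hasDerivAt_id x).mul_const (t : ℂ)
      have h2 := (hJd (x * t)).hasDerivAt.comp x h1
      have h3 := (h2.pow 2).const_mul ((t : ℂ) + 1)
      simpa [hF, hF', Function.comp_def] using h3)
  exact key.2.differentiableAt

lemma BornB_eventually (n : ℕ) (z : ℂ) : ∀ᶠ k in nhdsWithin z {z}ᶜ, BornB n k ≠ 0 := by
  have han : AnalyticOnNhd ℂ (BornB n) Set.univ := fun w _ =>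
    (BornB_differentiable n).analyticAt w
  rcases (han z trivial).eventually_eq_zero_or_eventually_ne_zero with h | h
  · exfalso
    have := han.eqOn_zero_of_preconnected_of_eventuallyEq_zero isPreconnected_univ
      (Set.mem_univ z) h (Set.mem_univ (1 : ℂ))
    exact BornB_ne_zero n 1 one_ne_zero (by simp) this
  · exact h

theorem stmt_7 (z : ℂ) :
    ¬ AccPt z (Filter.principal {k : ℂ | ∃ n : ℕ, BornB n k = 0}) := by
  rw [accPt_iff_frequently_nhdsNE, Filter.not_frequently]
  obtain ⟨N, hN⟩ := exists_nat_ge ((‖z‖ + 1) ^ 2)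
  have h1 : ∀ᶠ k in nhdsWithin z {z}ᶜ, ∀ n ∈ Finset.range N, BornB n k ≠ 0 :=
    (Filter.eventually_all_finset _).2 fun n _ => BornB_eventually n z
  have h2 : ∀ᶠ k in nhdsWithin z {z}ᶜ, k ∈ Metric.ball z 1 :=
    nhdsWithin_le_nhds (Metric.ball_mem_nhds z one_pos)
  have h3 : ∀ᶠ k in nhdsWithin z {z}ᶜ, k ≠ 0 := by
    by_cases hz : z = 0
    · subst hz
      exact self_mem_nhdsWithin
    · exact nhdsWithin_le_nhds (isOpen_ne.mem_nhds hz)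
  filter_upwards [h1, h2, h3] with k hk1 hk2 hk3
  rintro ⟨n, hn⟩
  by_cases hnN : n < N
  · exact hk1 n (Finset.mem_range.2 hnN) hn
  · refine BornB_ne_zero n k hk3 ?_ hn
    have hle : ‖k‖ ≤ ‖z‖ + 1 := by
      have := norm_le_norm_add_norm_sub' k z
      have h4 : ‖k - z‖ < 1 := by simpa [dist_eq_norm] using hk2
      linarith
    have h5 : (N : ℝ) ≤ n := by exact_mod_cast not_lt.1 hnN
    have h6 : ‖k‖ ^ 2 ≤ (‖z‖ + 1) ^ 2 := by gcongr
    linarith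
end

section
/- There exists c > 0 such that for every integer n ≥ 0 and every k ∈ ℂ with k ≠ 0 and |Im k| < c, one has B_n(k) ≠ 0. (Equivalently, the horizontal strip {k ∈ ℂ : |Im k| < c} contains no Born transmission eigenvalue in dimension d = 2.) -/
open MeasureTheory intervalIntegral Complex

namespace BornAux

/-- Coefficients of the normalized Bessel function. -/
noncomputable def cf (n m : ℕ) : ℂ :=
  (-1) ^ m / ((Nat.factorial m : ℂ) * (Nat.factorial (m + n) : ℂ))

/-- The entire function `g_n` with `J_n(z) = (z/2)^n g_n(z^2/4)`. -/
noncomputable def gC (n : ℕ) (w : ℂ) : ℂ := ∑' m : ℕ, cf n m * w ^ m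

lemma norm_cf_le (n m : ℕ) : ‖cf n m‖ ≤ 1 / (Nat.factorial m : ℝ) := by
  unfold cf
  rw [norm_div, norm_mul, norm_pow, norm_neg, norm_one, one_pow, Complex.norm_natCast,
    Complex.norm_natCast]
  have h1 : (0:ℝ) < Nat.factorial m := by exact_mod_cast Nat.factorial_pos m
  have h2 : (1:ℝ) ≤ Nat.factorial (m + n) := by exact_mod_cast Nat.factorial_pos (m + n)
  apply one_div_le_one_div_of_le h1
  nlinarith

lemma norm_term_le (n m : ℕ) (w : ℂ) : ‖cf n m * w ^ m‖ ≤ ‖w‖ ^ m / (Nat.factorial m : ℝ) := by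
  rw [norm_mul, norm_pow]
  have := mul_le_mul_of_nonneg_right (norm_cf_le n m) (pow_nonneg (norm_nonneg w) m)
  calc _ ≤ _ := this
    _ = _ := by ring

lemma summable_term (n : ℕ) (w : ℂ) : Summable (fun m => cf n m * w ^ m) :=
  Summable.of_norm_bounded (Real.summable_pow_div_factorial ‖w‖) (fun m => norm_term_le n m w)

lemma norm_gC_le (n : ℕ) (w : ℂ) : ‖gC n w‖ ≤ Real.exp ‖w‖ := by
  have h := NormedSpace.expSeries_div_hasSum_exp (𝔸 := ℝ) ‖w‖
  rw [← Real.exp_eq_exp_ℝ] at h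
  exact tsum_of_norm_bounded h (fun m => norm_term_le n m w)

lemma cf_succ (n m : ℕ) : cf n (m + 1) * ((m + 1 : ℕ) : ℂ) = - cf (n + 1) m := by
  unfold cf
  have h1 : (Nat.factorial m : ℂ) ≠ 0 := by exact_mod_cast Nat.factorial_ne_zero m
  have h2 : (Nat.factorial (m + 1 + n) : ℂ) ≠ 0 := by exact_mod_cast Nat.factorial_ne_zero _
  have h3 : ((m : ℂ) + 1) ≠ 0 := by exact_mod_cast Nat.succ_ne_zero m
  rw [show m + (n + 1) = m + 1 + n by ring, Nat.factorial_succ m]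
  push_cast
  field_simp
  ring

lemma hasDerivAt_gC (n : ℕ) (w : ℂ) : HasDerivAt (gC n) (- gC (n + 1) w) w := by
  have hw : w ∈ Metric.ball (0:ℂ) (‖w‖ + 1) := by simp
  have key : ∀ m y, cf n m * ((m : ℂ) * y ^ (m - 1)) =
      match m with | 0 => 0 | k + 1 => - (cf (n+1) k * y ^ k) := by
    intro m y
    cases m with
    | zero => simp
    | succ k =>
      simp only [Nat.add_sub_cancel]
      rw [← mul_assoc, cf_succ]; ring
  let u : ℕ → ℝ := fun m => match m with
    | 0 => 0
    | k + 1 => (‖w‖ + 1) ^ k / (Nat.factorial k : ℝ)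
  have hu : Summable u := by
    rw [← summable_nat_add_iff 1]
    exact Real.summable_pow_div_factorial (‖w‖ + 1)
  have h := hasDerivAt_tsum_of_isPreconnected (g := fun m y => cf n m * y ^ m)
    (g' := fun m y => cf n m * ((m : ℂ) * y ^ (m - 1))) hu (Metric.isOpen_ball)
    (convex_ball (0:ℂ) (‖w‖ + 1)).isPreconnected
    (fun m y _ => (hasDerivAt_pow m y).const_mul (cf n m))
    (by
      intro m y hy
      rw [key]
      cases m with
      | zero => simp [u]
      | succ k =>
        simp only [norm_neg, u]
        refine (norm_term_le (n+1) k y).trans ?_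
        have : ‖y‖ ≤ ‖w‖ + 1 := by
          have := hy; rw [mem_ball_zero_iff] at this; exact this.le
        gcongr)
    hw (summable_term n w) hw
  have h2 : (∑' m, cf n m * ((m : ℂ) * w ^ (m - 1))) = - gC (n + 1) w := by
    have hs : Summable (fun m => cf n m * ((m : ℂ) * w ^ (m - 1))) := by
      rw [← summable_nat_add_iff 1]
      simp only [key]
      exact (summable_term (n+1) w).neg
    rw [hs.tsum_eq_zero_add]
    simp only [key]
    rw [zero_add, tsum_neg]; rfl
  rw [h2] at h
  exact h

lemma differentiable_gC (n : ℕ) : Differentiable ℂ (gC n) :=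
  fun w => (hasDerivAt_gC n w).differentiableAt

lemma continuous_gC (n : ℕ) : Continuous (gC n) := (differentiable_gC n).continuous

lemma iteratedDeriv_gC (n m : ℕ) : iteratedDeriv m (gC n) = fun w => (-1) ^ m * gC (n + m) w := by
  induction m with
  | zero => simp
  | succ k ih =>
    rw [iteratedDeriv_succ, ih]
    funext w
    rw [((hasDerivAt_gC (n + k) w).const_mul ((-1) ^ k)).deriv]
    rw [pow_succ, add_assoc]; ring

lemma taylor_gC (n : ℕ) (w h : ℂ) :
    HasSum (fun m : ℕ => (-h) ^ m / (Nat.factorial m : ℂ) * gC (n + m) w) (gC n (w + h)) := by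
  have := Complex.hasSum_taylorSeries_of_entire (differentiable_gC n) w (w + h)
  have e : (fun m : ℕ => (-h) ^ m / (Nat.factorial m : ℂ) * gC (n + m) w) =
      (fun m : ℕ => (Nat.factorial m : ℂ)⁻¹ • (w + h - w) ^ m • iteratedDeriv m (gC n) w) := by
    funext m
    rw [iteratedDeriv_gC]
    simp only [smul_eq_mul, add_sub_cancel_left]
    rw [neg_pow]; ring
  rw [e]
  exact this

/-- three-term recurrence -/
lemma rec_gC (n : ℕ) (w : ℂ) :
    gC n w = (n + 1) * gC (n + 1) w - w * gC (n + 2) w := by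
  have h0 := (summable_term n w).hasSum
  have h1 := ((summable_term (n + 1) w).hasSum).mul_left ((n : ℂ) + 1)
  have h2 := ((summable_term (n + 2) w).hasSum).mul_left w
  have h3 : HasSum (fun m => match m with
      | 0 => 0
      | k + 1 => w * (cf (n + 2) k * w ^ k)) (w * gC (n + 2) w) := by
    rw [← hasSum_nat_add_iff' 1]
    simp only [Finset.range_one, Finset.sum_singleton, sub_zero]
    exact h2
  have h4 := h1.sub h3
  refine h0.unique ?_
  refine HasSum.congr_fun h4 ?_
  intro m
  cases m with
  | zero =>
    simp [cf, Nat.factorial_succ]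
    have h1 : (Nat.factorial n : ℂ) ≠ 0 := by exact_mod_cast Nat.factorial_ne_zero n
    have h3 : ((n : ℂ) + 1) ≠ 0 := by exact_mod_cast Nat.succ_ne_zero n
    field_simp
  | succ k =>
    have h1 : (Nat.factorial k : ℂ) ≠ 0 := by exact_mod_cast Nat.factorial_ne_zero k
    have h2 : (Nat.factorial (k + n + 1) : ℂ) ≠ 0 := by exact_mod_cast Nat.factorial_ne_zero _
    have h3 : ((k : ℂ) + 1) ≠ 0 := by exact_mod_cast Nat.succ_ne_zero k
    have h4 : ((k : ℂ) + n + 1 + 1) ≠ 0 := by exact_mod_cast Nat.succ_ne_zero (k + n + 1)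
    simp only [cf]
    rw [show k + 1 + n = k + n + 1 by ring, show k + 1 + (n + 1) = k + n + 1 + 1 by ring,
      show k + (n + 2) = k + n + 1 + 1 by ring, Nat.factorial_succ k,
      Nat.factorial_succ (k + n + 1)]
    push_cast
    field_simp
    ring

lemma gC_zero (n : ℕ) : gC n 0 = 1 / (Nat.factorial n : ℂ) := by
  unfold gC
  rw [tsum_eq_single 0]
  · simp [cf]
  · intro m hm; simp [hm]

/-- real version -/
noncomputable def gR (n : ℕ) (x : ℝ) : ℝ := (gC n (x : ℂ)).re

lemma gC_ofReal (n : ℕ) (x : ℝ) : gC n (x : ℂ) = (gR n x : ℂ) := by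
  have : ∃ r : ℝ, gC n (x : ℂ) = (r : ℂ) := by
    refine ⟨∑' m : ℕ, ((-1) ^ m / ((Nat.factorial m : ℝ) * (Nat.factorial (m + n) : ℝ))) * x ^ m, ?_⟩
    rw [Complex.ofReal_tsum]
    unfold gC cf
    push_cast
    rfl
  obtain ⟨r, hr⟩ := this
  rw [gR, hr, Complex.ofReal_re]

lemma hasDerivAt_gR (n : ℕ) (x : ℝ) : HasDerivAt (gR n) (- gR (n + 1) x) x := by
  have := (hasDerivAt_gC n (x : ℂ)).real_of_complex
  rw [Complex.neg_re] at this
  exact this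

lemma rec_gR (n : ℕ) (x : ℝ) :
    gR n x = (n + 1) * gR (n + 1) x - x * gR (n + 2) x := by
  have := rec_gC n (x : ℂ)
  rw [gC_ofReal, gC_ofReal, gC_ofReal] at this
  exact_mod_cast this

lemma continuous_gR (n : ℕ) : Continuous (gR n) :=
  continuous_iff_continuousAt.2 fun x => (hasDerivAt_gR n x).continuousAt

lemma abs_gR_le (n : ℕ) (x : ℝ) : |gR n x| ≤ Real.exp |x| := by
  have := norm_gC_le n (x : ℂ)
  rwa [gC_ofReal, Complex.norm_real, Complex.norm_real] at this

lemma gR_zero (n : ℕ) : gR n 0 = 1 / (Nat.factorial n : ℝ) := by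
  have := gC_zero n
  rw [gR, Complex.ofReal_zero, this, ← Complex.ofReal_natCast, ← Complex.ofReal_one,
    ← Complex.ofReal_div, Complex.ofReal_re]

lemma gR_nonneg (n : ℕ) (hn : n ≤ 1) (x : ℝ) (h0 : 0 ≤ x) (h1 : x ≤ 1 / 4) : 0 ≤ gR n x := by
  have hz : gR n 0 = 1 := by
    rw [gR_zero]; interval_cases n <;> simp
  have he : Real.exp (1/4) ≤ 4 / 3 := by
    have := Real.exp_bound_div_one_sub_of_interval (x := 1/4) (by norm_num) (by norm_num)
    norm_num at this ⊢
    exact this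
  have hb := (convex_Icc (0:ℝ) (1/4)).norm_image_sub_le_of_norm_hasDerivWithin_le
    (f := gR n) (f' := fun y => - gR (n+1) y) (C := 4/3) (x := 0) (y := x)
    (fun y _ => (hasDerivAt_gR n y).hasDerivWithinAt)
    (fun y hy => by
      rw [norm_neg]
      refine (abs_gR_le (n+1) y).trans (le_trans ?_ he)
      rw [abs_of_nonneg hy.1]
      exact Real.exp_le_exp.2 hy.2) (by norm_num) ⟨h0, h1⟩
  rw [hz, Real.norm_eq_abs, Real.norm_eq_abs, sub_zero, abs_of_nonneg h0] at hb
  have := (abs_le.1 hb).1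
  linarith

/-- Real Bessel function. -/
noncomputable def jR (n : ℕ) (x : ℝ) : ℝ := (x / 2) ^ n * gR n (x ^ 2 / 4)

lemma continuous_jR (n : ℕ) : Continuous (jR n) := by
  unfold jR
  have := continuous_gR n
  fun_prop

lemma besselJ_eq (n : ℕ) (z : ℂ) : besselJ n z = (z / 2) ^ n * gC n (z ^ 2 / 4) := by
  unfold besselJ gC
  rw [← tsum_mul_left]
  congr 1; funext m
  rw [cf, pow_add, pow_mul, show z ^ 2 / 4 = (z / 2) ^ 2 by ring]; ring

/-- Derivative of the Bessel function, in divided form. -/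
lemma hasDerivAt_jR (n : ℕ) (x : ℝ) (hx : x ≠ 0) :
    HasDerivAt (jR n) (n / x * jR n x - jR (n + 1) x) x := by
  have h1 : HasDerivAt (fun y : ℝ => (y / 2) ^ n) (n * (x / 2) ^ (n - 1) * (1 / 2)) x :=
    ((hasDerivAt_id x).div_const 2).pow n
  have h2 : HasDerivAt (fun y : ℝ => y ^ 2 / 4) (x / 2) x := by
    have := (hasDerivAt_pow 2 x).div_const 4
    refine this.congr_deriv ?_
    simp only [Nat.add_one_sub_one, pow_one, Nat.cast_ofNat]
    linarith
  have h3 := (hasDerivAt_gR n (x ^ 2 / 4)).comp x h2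
  have h4 := h1.mul h3
  refine h4.congr_deriv ?_
  simp only [Function.comp_apply, jR]
  cases n with
  | zero => simp [mul_comm]
  | succ k =>
    simp only [Nat.add_sub_cancel]
    field_simp
    ring

lemma hasDerivAt_jR' (n : ℕ) (x : ℝ) (hx : x ≠ 0) :
    HasDerivAt (jR (n + 1)) (jR n x - (n + 1) / x * jR (n + 1) x) x := by
  refine (hasDerivAt_jR (n + 1) x hx).congr_deriv ?_
  have := rec_gR n (x ^ 2 / 4)
  simp only [jR]
  rw [this]
  push_cast
  field_simp
  ring

end BornAux
namespace BornAux

/-- `z R_n(z) = ∫_0^z s J_n(s)^2 ds`. -/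
lemma R_nonneg (n : ℕ) (z : ℝ) (hz : 0 ≤ z) :
    0 ≤ 1 / 2 * z ^ 2 * (jR n z ^ 2 + jR (n + 1) z ^ 2) - n * z * (jR n z * jR (n + 1) z) := by
  have ca := continuous_jR n
  have cb := continuous_jR (n + 1)
  set P : ℝ → ℝ := fun z =>
    1 / 2 * z ^ 2 * (jR n z ^ 2 + jR (n + 1) z ^ 2) - n * z * (jR n z * jR (n + 1) z) with hP
  have hd : ∀ y, 0 < y → HasDerivAt P (y * jR n y ^ 2) y := by
    intro y hy
    have ha := hasDerivAt_jR n y hy.ne'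
    have hb := hasDerivAt_jR' n y hy.ne'
    have h := (((hasDerivAt_pow 2 y).const_mul (1/2)).mul ((ha.pow 2).add (hb.pow 2))).sub
      (((hasDerivAt_id y).const_mul (n:ℝ)).mul (ha.mul hb))
    refine (h.congr_deriv ?_)
    simp only [Pi.mul_apply, Pi.pow_apply, Pi.add_apply, id]
    push_cast
    field_simp
    ring
  have hm : MonotoneOn P (Set.Ici 0) := by
    apply monotoneOn_of_deriv_nonneg (convex_Ici 0)
    · apply Continuous.continuousOn; simp only [hP]; fun_prop
    · intro y hy
      rw [interior_Ici] at hy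
      exact (hd y hy).differentiableAt.differentiableWithinAt
    · intro y hy
      rw [interior_Ici] at hy
      have hy' : 0 < y := hy
      rw [(hd y hy').deriv]
      positivity
  have := hm (Set.mem_Ici.2 le_rfl) (Set.mem_Ici.2 hz) hz
  have h0 : P 0 = 0 := by simp [hP]
  rw [h0] at this
  exact this

lemma jR_nonneg (n : ℕ) (hn : n ≤ 1) (z : ℝ) (h0 : 0 ≤ z) (h1 : z ≤ 1) : 0 ≤ jR n z := by
  unfold jR
  have := gR_nonneg n hn (z ^ 2 / 4) (by positivity) (by nlinarith)
  positivity

lemma Q_nonneg (n : ℕ) (z : ℝ) (hz : 0 ≤ z) :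
    0 ≤ 1 / 2 * z * (jR n z ^ 2 + jR (n + 1) z ^ 2) - ((n : ℝ) - 1) * (jR n z * jR (n + 1) z) := by
  rcases hz.eq_or_lt with rfl | hz
  · simp [jR]
  have hR := R_nonneg n z hz.le
  set a := jR n z with ha
  set b := jR (n + 1) z with hb
  by_cases hab : 0 ≤ a * b
  · have : 0 ≤ 1 / 2 * z * (a ^ 2 + b ^ 2) - n * (a * b) := by
      refine nonneg_of_mul_nonneg_right (a := z) (b := 1 / 2 * z * (a ^ 2 + b ^ 2) - n * (a * b))
        ?_ hz
      linarith
    linarith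
  · push Not at hab
    have hp : 0 ≤ 1 / 2 * z * (a ^ 2 + b ^ 2) := by positivity
    rcases Nat.eq_zero_or_pos n with rfl | hn
    · have hz1 : 1 < z := by
        by_contra hcon
        push Not at hcon
        have h1 := jR_nonneg 0 (by norm_num) z hz.le hcon
        have h2 := jR_nonneg 1 (by norm_num) z hz.le hcon
        have : 0 ≤ a * b := mul_nonneg h1 h2
        linarith
      push_cast
      nlinarith [sq_nonneg (a + b), sq_nonneg a, sq_nonneg b]
    · have : (1:ℝ) ≤ n := by exact_mod_cast hn
      nlinarith

lemma int_ineq (n : ℕ) (x : ℝ) (hx : 0 < x) :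
    0 ≤ ∫ z in (0:ℝ)..x, (1 + z / x) * (2 * jR n z ^ 2 - jR (n + 1) z ^ 2) := by
  have ca := continuous_jR n
  have cb := continuous_jR (n + 1)
  set Q : ℝ → ℝ := fun z =>
    1 / 2 * z * (jR n z ^ 2 + jR (n + 1) z ^ 2) - ((n : ℝ) - 1) * (jR n z * jR (n + 1) z) with hQ
  have cQ : Continuous Q := by simp only [hQ]; fun_prop
  have hd : ∀ y, 0 < y → HasDerivAt Q (2 * jR n y ^ 2 - jR (n + 1) y ^ 2 - Q y / y) y := by
    intro y hy
    have ha := hasDerivAt_jR n y hy.ne'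
    have hb := hasDerivAt_jR' n y hy.ne'
    have h := (((hasDerivAt_id y).const_mul (1/2)).mul ((ha.pow 2).add (hb.pow 2))).sub
      ((ha.mul hb).const_mul ((n:ℝ) - 1))
    refine (h.congr_deriv ?_)
    simp only [Pi.mul_apply, Pi.pow_apply, Pi.add_apply, id, hQ]
    push_cast
    field_simp
    ring
  have cf : Continuous fun z : ℝ => (1 + z / x) * (2 * jR n z ^ 2 - jR (n + 1) z ^ 2) := by
    fun_prop
  set Φ : ℝ → ℝ := fun s =>
    (∫ z in (0:ℝ)..s, (1 + z / x) * (2 * jR n z ^ 2 - jR (n + 1) z ^ 2)) - (1 + s / x) * Q s with hΦ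
  have hI : ∀ s, HasDerivAt (fun s => ∫ z in (0:ℝ)..s,
      (1 + z / x) * (2 * jR n z ^ 2 - jR (n + 1) z ^ 2))
      ((1 + s / x) * (2 * jR n s ^ 2 - jR (n + 1) s ^ 2)) s := fun s =>
    cf.integral_hasStrictDerivAt 0 s |>.hasDerivAt
  have hdΦ : ∀ y, 0 < y → HasDerivAt Φ (Q y / y) y := by
    intro y hy
    have h := (hI y).sub ((((hasDerivAt_id y).div_const x).const_add 1).mul (hd y hy))
    refine h.congr_deriv ?_
    simp only [id]
    field_simp
    ring
  have hm : MonotoneOn Φ (Set.Ici 0) := by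
    apply monotoneOn_of_deriv_nonneg (convex_Ici 0)
    · apply Continuous.continuousOn
      have : Continuous fun s => ∫ z in (0:ℝ)..s,
        (1 + z / x) * (2 * jR n z ^ 2 - jR (n + 1) z ^ 2) :=
        continuous_iff_continuousAt.2 fun s => (hI s).continuousAt
      simp only [hΦ]; fun_prop
    · intro y hy
      rw [interior_Ici] at hy
      exact (hdΦ y hy).differentiableAt.differentiableWithinAt
    · intro y hy
      rw [interior_Ici] at hy
      have hy' : 0 < y := hy
      rw [(hdΦ y hy').deriv]
      exact div_nonneg (Q_nonneg n y hy'.le) hy'.le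
  have h1 := hm (Set.mem_Ici.2 le_rfl) (Set.mem_Ici.2 hx.le) hx.le
  have h0 : Φ 0 = 0 := by simp [hΦ, hQ, jR]
  rw [h0] at h1
  simp only [hΦ] at h1
  have h2 := Q_nonneg n x hx.le
  have h3 : 0 ≤ (1 + x / x) * Q x := mul_nonneg (by positivity) h2
  linarith

/-- The real Born integral. -/
noncomputable def bR (n : ℕ) (x : ℝ) : ℝ := ∫ t in (0:ℝ)..1, (1 + t) * jR n (x * t) ^ 2

lemma bR_succ_le (n : ℕ) (x : ℝ) (hx : 0 < x) : bR (n + 1) x ≤ 2 * bR n x := by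
  have ca := continuous_jR n
  have cb := continuous_jR (n + 1)
  have h := int_ineq n x hx
  have h2 := intervalIntegral.mul_integral_comp_mul_left (a := 0) (b := 1) (c := x)
    (f := fun z => (1 + z / x) * (2 * jR n z ^ 2 - jR (n + 1) z ^ 2))
  rw [mul_zero, mul_one] at h2
  rw [← h2] at h
  have h3 := nonneg_of_mul_nonneg_right h hx
  have h4 : (∫ t in (0:ℝ)..1, (1 + x * t / x) * (2 * jR n (x * t) ^ 2 - jR (n + 1) (x * t) ^ 2))
      = 2 * bR n x - bR (n + 1) x := by
    unfold bR
    rw [← intervalIntegral.integral_const_mul, ← intervalIntegral.integral_sub]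
    · congr 1; funext t
      field_simp
    · apply Continuous.intervalIntegrable; fun_prop
    · apply Continuous.intervalIntegrable; fun_prop
  linarith

lemma bR_add_le (n m : ℕ) (x : ℝ) (hx : 0 < x) : bR (n + m) x ≤ 2 ^ m * bR n x := by
  induction m with
  | zero => simp
  | succ k ih =>
    have := bR_succ_le (n + k) x hx
    rw [← add_assoc, pow_succ]
    linarith

lemma bR_pos (n : ℕ) (x : ℝ) (hx : 0 < x) : 0 < bR n x := by
  have ca := continuous_jR n
  have hc : Continuous fun t : ℝ => gR n ((x * t) ^ 2 / 4) := by
    have := continuous_gR n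
    fun_prop
  have hg : ∀ᶠ t in nhds (0:ℝ), 0 < gR n ((x * t) ^ 2 / 4) := by
    apply hc.continuousAt.eventually
    apply lt_mem_nhds
    simp only [mul_zero, ne_eq, OfNat.ofNat_ne_zero, not_false_eq_true, zero_pow, zero_div]
    rw [gR_zero]
    positivity
  obtain ⟨δ, hδ, hball⟩ := Metric.eventually_nhds_iff.1 hg
  have hm : 0 < min (δ / 2) 1 := by positivity
  set t := min (δ / 2) 1 with ht
  have h1 : t ≤ 1 := min_le_right _ _
  have h2 : t ≤ δ / 2 := min_le_left _ _
  have hp : 0 < gR n ((x * t) ^ 2 / 4) := by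
    apply hball
    rw [Real.dist_eq, sub_zero, abs_of_pos hm]
    linarith
  apply intervalIntegral.integral_pos one_pos
  · apply Continuous.continuousOn; fun_prop
  · intro y hy
    have := hy.1
    positivity
  · refine ⟨t, ⟨hm.le, h1⟩, ?_⟩
    have : 0 < jR n (x * t) := by unfold jR; positivity
    positivity

end BornAux
namespace BornAux

lemma expansion (n : ℕ) (k : ℂ) (hk : k ≠ 0) (x : ℝ) (hx : 0 < x) (t : ℝ) :
    HasSum (fun m : ℕ => ((((x:ℂ) ^ 2 - k ^ 2) / (2 * x)) * t) ^ m / (Nat.factorial m : ℂ) *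
      (jR (n + m) (x * t) : ℂ)) (((x:ℂ) / k) ^ n * besselJ n (k * t)) := by
  have hx' : (x:ℂ) ≠ 0 := by exact_mod_cast hx.ne'
  have h := (taylor_gC n (((x * t) ^ 2 / 4 : ℝ) : ℂ)
    ((k * t) ^ 2 / 4 - (((x * t) ^ 2 / 4 : ℝ) : ℂ))).mul_left (((x:ℂ) * t / 2) ^ n)
  rw [besselJ_eq]
  have e1 : ((x:ℂ) / k) ^ n * ((k * t / 2) ^ n * gC n ((k * t) ^ 2 / 4)) =
      ((x:ℂ) * t / 2) ^ n * gC n ((((x * t) ^ 2 / 4 : ℝ) : ℂ) +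
        ((k * t) ^ 2 / 4 - (((x * t) ^ 2 / 4 : ℝ) : ℂ))) := by
    rw [add_sub_cancel, ← mul_assoc, ← mul_pow]
    congr 2
    field_simp
  rw [e1]
  refine h.congr_fun ?_
  intro m
  rw [gC_ofReal, jR]
  push_cast
  have e2 : -((k * t) ^ 2 / 4 - ((x:ℂ) * t) ^ 2 / 4) =
      ((((x:ℂ) ^ 2 - k ^ 2) / (2 * x)) * t) * ((x:ℂ) * t / 2) := by
    field_simp
    ring
  rw [e2]
  generalize (((x:ℂ) ^ 2 - k ^ 2) / (2 * x)) * t = σ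
  generalize (x:ℂ) * t / 2 = τ
  rw [mul_pow, pow_add]
  ring

lemma norm_s (k : ℂ) (hk : k ≠ 0) :
    ‖(((‖k‖:ℝ):ℂ) ^ 2 - k ^ 2) / (2 * ((‖k‖:ℝ):ℂ))‖ = |k.im| := by
  have hn : ‖k‖ ≠ 0 := norm_ne_zero_iff.2 hk
  have h1 : ((‖k‖:ℝ):ℂ) ^ 2 - k ^ 2 = - (2 * k.im * Complex.I) * k := by
    have h2 := Complex.sub_conj k
    push_cast at h2
    rw [← Complex.conj_mul', ← h2]
    ring
  rw [h1]
  simp only [norm_div, norm_mul, norm_neg, Complex.norm_I, Complex.norm_real,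
    Real.norm_eq_abs]
  simp
  field_simp

lemma exp_tail (r : ℝ) :
    HasSum (fun m : ℕ => r ^ (m + 1) / (Nat.factorial (m + 1) : ℝ)) (Real.exp r - 1) := by
  have h := NormedSpace.expSeries_div_hasSum_exp (𝔸 := ℝ) r
  rw [← Real.exp_eq_exp_ℝ] at h
  rw [← hasSum_nat_add_iff' 1] at h
  simpa using h

lemma abs_jR_le (n : ℕ) (x t : ℝ) (hx : 0 < x) (h0 : 0 ≤ t) (h1 : t ≤ 1) :
    |jR n (x * t)| ≤ (x / 2) ^ n * Real.exp (x ^ 2 / 4) := by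
  unfold jR
  have hxt : x * t ≤ x := by nlinarith
  have hxt0 : 0 ≤ x * t := by positivity
  rw [abs_mul, abs_of_nonneg (by positivity)]
  gcongr
  refine (abs_gR_le _ _).trans (Real.exp_le_exp.2 ?_)
  rw [abs_of_nonneg (by positivity)]
  gcongr

lemma main_nonzero (n : ℕ) (k : ℂ) (hk : k ≠ 0)
    (hc : (Real.exp |k.im| - 1) * (Real.exp (2 * |k.im|) - 1) < 1 / 6) : BornB n k ≠ 0 := by
  intro hB
  set x : ℝ := ‖k‖ with hxdef
  have hx : 0 < x := norm_pos_iff.2 hk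
  set r : ℝ := |k.im| with hr
  have hr0 : 0 ≤ r := abs_nonneg _
  set s : ℂ := (((x:ℂ) ^ 2 - k ^ 2) / (2 * x)) with hs
  have hsn : ‖s‖ = r := norm_s k hk
  have hEr : 0 ≤ Real.exp r - 1 := by linarith [Real.add_one_le_exp r]
  -- functions
  set U : ℝ → ℂ := fun t => ((x:ℂ) / k) ^ n * besselJ n (k * t) with hU
  set V : ℝ → ℝ := fun t => jR n (x * t) with hV
  set W : ℝ → ℂ := fun t => U t - V t with hW
  have cV : Continuous V := by
    have := continuous_jR n
    simp only [hV]; fun_prop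
  have cU : Continuous U := by
    have := continuous_gC n
    simp only [hU, besselJ_eq]; fun_prop
  have cW : Continuous W := by simp only [hW]; fun_prop
  have hWsum : ∀ t : ℝ, HasSum (fun m : ℕ => (s * t) ^ (m + 1) / (Nat.factorial (m + 1) : ℂ) *
      (jR (n + (m + 1)) (x * t) : ℂ)) (W t) := by
    intro t
    have h := expansion n k hk x hx t
    rw [← hasSum_nat_add_iff' 1] at h
    simpa using h
  -- weights
  set q : ℕ → ℝ := fun m => r ^ (m + 1) / (Nat.factorial (m + 1) : ℝ) with hq
  have hq0 : ∀ m, 0 ≤ q m := fun m => by simp only [hq]; positivity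
  have hqs : HasSum q (Real.exp r - 1) := exp_tail r
  set v : ℕ → ℝ → ℝ := fun m t => jR (n + (m + 1)) (x * t) with hv
  have cv : ∀ m, Continuous (v m) := fun m => by
    have := continuous_jR (n + (m + 1))
    simp only [hv]; fun_prop
  set bd : ℕ → ℝ := fun m => q m * ((x / 2) ^ (n + (m + 1)) * Real.exp (x ^ 2 / 4)) ^ 2 with hbd
  have hbds : Summable bd := by
    have h1 := (exp_tail (r * (x / 2) ^ 2)).summable.mul_right
      (((x / 2) ^ n * Real.exp (x ^ 2 / 4)) ^ 2)
    refine h1.congr ?_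
    intro m
    simp only [hbd, hq]
    generalize x / 2 = τ
    ring
  have hle : ∀ m t, 0 ≤ t → t ≤ 1 → q m * v m t ^ 2 ≤ bd m := by
    intro m t h0 h1
    simp only [hbd]
    refine mul_le_mul_of_nonneg_left ?_ (hq0 m)
    rw [← sq_abs]
    exact pow_le_pow_left₀ (abs_nonneg _) (abs_jR_le _ x t hx h0 h1) 2
  have hTs : ∀ t, 0 ≤ t → t ≤ 1 → Summable fun m => q m * v m t ^ 2 := fun t h0 h1 =>
    Summable.of_nonneg_of_le (fun m => mul_nonneg (hq0 m) (sq_nonneg _)) (fun m => hle m t h0 h1)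
      hbds
  set T : ℝ → ℝ := fun t => ∑' m, q m * v m t ^ 2 with hT
  -- pointwise Cauchy-Schwarz
  have hCS : ∀ t, 0 ≤ t → t ≤ 1 → ‖W t‖ ^ 2 ≤ (Real.exp r - 1) * T t := by
    intro t h0 h1
    have hlim := (((hWsum t).tendsto_sum_nat).norm).pow 2
    refine le_of_tendsto hlim (Filter.Eventually.of_forall fun N => ?_)
    have hterm : ∀ m, ‖(s * t) ^ (m + 1) / (Nat.factorial (m + 1) : ℂ) *
        (jR (n + (m + 1)) (x * t) : ℂ)‖ ≤ q m * |v m t| := by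
      intro m
      rw [norm_mul, norm_div, norm_pow, norm_mul, hsn, Complex.norm_natCast, Complex.norm_real,
        Complex.norm_real, Real.norm_eq_abs, Real.norm_eq_abs, abs_of_nonneg h0]
      refine mul_le_mul_of_nonneg_right ?_ (abs_nonneg _)
      simp only [hq]
      have : r * t ≤ r := by nlinarith
      gcongr
    have hn1 : ‖∑ m ∈ Finset.range N, (s * t) ^ (m + 1) / (Nat.factorial (m + 1) : ℂ) *
        (jR (n + (m + 1)) (x * t) : ℂ)‖ ≤ ∑ m ∈ Finset.range N, q m * |v m t| :=
      (norm_sum_le _ _).trans (Finset.sum_le_sum fun m _ => hterm m)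
    have hn2 : (∑ m ∈ Finset.range N, q m * |v m t|) ^ 2 ≤
        (∑ m ∈ Finset.range N, q m) * ∑ m ∈ Finset.range N, q m * v m t ^ 2 := by
      apply Finset.sum_sq_le_sum_mul_sum_of_sq_le_mul
      · intro m _; exact hq0 m
      · intro m _; exact mul_nonneg (hq0 m) (sq_nonneg _)
      · intro m _; rw [mul_pow, sq_abs]; exact le_of_eq (by ring)
    have hn3 : ∑ m ∈ Finset.range N, q m ≤ Real.exp r - 1 :=
      sum_le_hasSum _ (fun m _ => hq0 m) hqs
    have hn4 : ∑ m ∈ Finset.range N, q m * v m t ^ 2 ≤ T t :=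
      (hTs t h0 h1).sum_le_tsum _ (fun m _ => mul_nonneg (hq0 m) (sq_nonneg _))
    refine (pow_le_pow_left₀ (norm_nonneg _) hn1 2).trans (hn2.trans ?_)
    exact mul_le_mul hn3 hn4 (Finset.sum_nonneg fun m _ => mul_nonneg (hq0 m) (sq_nonneg _)) hEr
  -- integrate the series
  have hTsum : HasSum (fun m => ∫ t in (0:ℝ)..1, (1 + t) * (q m * v m t ^ 2))
      (∫ t in (0:ℝ)..1, (1 + t) * T t) := by
    refine intervalIntegral.hasSum_integral_of_dominated_convergence (fun m _ => 2 * bd m)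
      ?_ ?_ ?_ ?_ ?_
    · intro m
      have := cv m
      apply Continuous.aestronglyMeasurable
      fun_prop
    · intro m
      refine Filter.Eventually.of_forall fun t ht => ?_
      rw [Set.uIoc_of_le zero_le_one] at ht
      have h3 := hle m t ht.1.le ht.2
      have h4 : 0 ≤ q m * v m t ^ 2 := mul_nonneg (hq0 m) (sq_nonneg _)
      have h5 := ht.1
      have h6 := ht.2
      rw [Real.norm_eq_abs, abs_of_nonneg (by positivity)]
      nlinarith
    · exact Filter.Eventually.of_forall fun t _ => hbds.mul_left 2
    · exact intervalIntegrable_const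
    · refine Filter.Eventually.of_forall fun t ht => ?_
      rw [Set.uIoc_of_le zero_le_one] at ht
      exact ((hTs t ht.1.le ht.2).hasSum).mul_left _
  have hTint : ∫ t in (0:ℝ)..1, (1 + t) * T t ≤ (Real.exp (2 * r) - 1) * bR n x := by
    refine hasSum_le ?_ hTsum ((exp_tail (2 * r)).mul_right (bR n x))
    intro m
    have e : (∫ t in (0:ℝ)..1, (1 + t) * (q m * v m t ^ 2)) = q m * bR (n + (m + 1)) x := by
      unfold bR
      rw [← intervalIntegral.integral_const_mul]
      congr 1; funext t; simp only [hv]; ring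
    rw [e]
    have h3 := mul_le_mul_of_nonneg_left (bR_add_le n (m + 1) x hx) (hq0 m)
    refine h3.trans (le_of_eq ?_)
    simp only [hq]
    rw [mul_pow]
    ring
  have hTii : IntervalIntegrable (fun t => (1 + t) * T t) volume 0 1 := by
    apply ContinuousOn.intervalIntegrable_of_Icc zero_le_one
    have hTc : ContinuousOn T (Set.Icc 0 1) := by
      refine continuousOn_tsum (fun m => ?_) hbds ?_
      · have := cv m
        apply Continuous.continuousOn; fun_prop
      · intro m t ht
        rw [Real.norm_eq_abs, abs_of_nonneg (mul_nonneg (hq0 m) (sq_nonneg _))]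
        exact hle m t ht.1 ht.2
    fun_prop
  have hWint : ∫ t in (0:ℝ)..1, (1 + t) * ‖W t‖ ^ 2 ≤
      (Real.exp r - 1) * ((Real.exp (2 * r) - 1) * bR n x) := by
    refine le_trans ?_ (mul_le_mul_of_nonneg_left hTint hEr)
    rw [← intervalIntegral.integral_const_mul]
    apply intervalIntegral.integral_mono_on zero_le_one
    · apply Continuous.intervalIntegrable; fun_prop
    · exact hTii.const_mul _
    · intro t ht
      have := hCS t ht.1 ht.2
      have h5 := ht.1
      nlinarith
  -- conclusion
  have hb := bR_pos n x hx
  have hU0 : ∫ t in (0:ℝ)..1, ((t:ℂ) + 1) * U t ^ 2 = 0 := by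
    have : (∫ t in (0:ℝ)..1, ((t:ℂ) + 1) * U t ^ 2) = (((x:ℂ) / k) ^ n) ^ 2 * BornB n k := by
      unfold BornB
      rw [← intervalIntegral.integral_const_mul]
      congr 1; funext t; simp only [hU]; ring
    rw [this, hB, mul_zero]
  have hV0 : ∫ t in (0:ℝ)..1, ((t:ℂ) + 1) * (V t : ℂ) ^ 2 = (bR n x : ℂ) := by
    unfold bR
    rw [← intervalIntegral.integral_ofReal]
    congr 1; funext t; push_cast; simp only [hV]; ring
  have hdiff : ∫ t in (0:ℝ)..1, ((t:ℂ) + 1) * (U t ^ 2 - (V t : ℂ) ^ 2) = - (bR n x : ℂ) := by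
    rw [← hV0, ← zero_sub, ← hU0, ← intervalIntegral.integral_sub]
    · congr 1; funext t; ring
    · apply Continuous.intervalIntegrable; fun_prop
    · apply Continuous.intervalIntegrable; fun_prop
  have hnorm : bR n x ≤ ∫ t in (0:ℝ)..1, (1 / 2 * ((1 + t) * V t ^ 2) + 3 * ((1 + t) * ‖W t‖ ^ 2)) := by
    have h1 : ‖∫ t in (0:ℝ)..1, ((t:ℂ) + 1) * (U t ^ 2 - (V t : ℂ) ^ 2)‖ = bR n x := by
      rw [hdiff, norm_neg, Complex.norm_real, Real.norm_eq_abs, abs_of_pos hb]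
    rw [← h1]
    apply intervalIntegral.norm_integral_le_of_norm_le zero_le_one
    · refine Filter.Eventually.of_forall fun t ht => ?_
      have ht0 := ht.1
      have e : U t ^ 2 - (V t : ℂ) ^ 2 = 2 * V t * W t + W t ^ 2 := by
        simp only [hW]; ring
      have e2 : ‖(t:ℂ) + 1‖ = 1 + t := by
        rw [← Complex.ofReal_one, ← Complex.ofReal_add, Complex.norm_real, Real.norm_eq_abs,
          abs_of_pos (by linarith)]
        ring
      rw [norm_mul, e2, e]
      have e3 : ‖2 * (V t : ℂ) * W t + W t ^ 2‖ ≤ 2 * |V t| * ‖W t‖ + ‖W t‖ ^ 2 := by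
        refine (norm_add_le _ _).trans (le_of_eq ?_)
        rw [norm_mul, norm_mul, norm_pow, Complex.norm_real, Real.norm_eq_abs]
        simp
      have e4 : 2 * |V t| * ‖W t‖ + ‖W t‖ ^ 2 ≤ 1 / 2 * V t ^ 2 + 3 * ‖W t‖ ^ 2 := by
        rw [← sq_abs (V t)]
        nlinarith [sq_nonneg (|V t| - 2 * ‖W t‖)]
      have := mul_le_mul_of_nonneg_left (e3.trans e4) (by linarith : 0 ≤ 1 + t)
      linarith
    · apply Continuous.intervalIntegrable; fun_prop
  rw [intervalIntegral.integral_add, intervalIntegral.integral_const_mul,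
    intervalIntegral.integral_const_mul] at hnorm
  · have : (∫ t in (0:ℝ)..1, (1 + t) * V t ^ 2) = bR n x := rfl
    rw [this] at hnorm
    have := mul_lt_mul_of_pos_right hc hb
    nlinarith
  · apply Continuous.intervalIntegrable; fun_prop
  · apply Continuous.intervalIntegrable; fun_prop

end BornAux

theorem stmt_8 :
    ∃ c : ℝ, 0 < c ∧ ∀ n : ℕ, ∀ k : ℂ, k ≠ 0 → |k.im| < c → BornB n k ≠ 0 := by
  refine ⟨1 / 10, by norm_num, fun n k hk hc => BornAux.main_nonzero n k hk ?_⟩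
  have h0 := abs_nonneg k.im
  have h1 : Real.exp |k.im| ≤ 10 / 9 := by
    have h := Real.exp_bound_div_one_sub_of_interval (x := 1/10) (by norm_num) (by norm_num)
    have h' := Real.exp_le_exp.2 hc.le
    norm_num at h
    norm_num only at h' ⊢
    linarith
  have h2 : Real.exp (2 * |k.im|) ≤ 5 / 4 := by
    have h := Real.exp_bound_div_one_sub_of_interval (x := 1/5) (by norm_num) (by norm_num)
    have h' : Real.exp (2 * |k.im|) ≤ Real.exp (1/5) := Real.exp_le_exp.2 (by linarith)
    norm_num at h
    norm_num only at h' ⊢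
    linarith
  have h3 := Real.add_one_le_exp |k.im|
  have h4 := Real.add_one_le_exp (2 * |k.im|)
  nlinarith
end

section
/- There exists a constant C > 0 such that |Im β(z)| ≤ C · |Im z| for every z ∈ ℂ with Re z > 1. -/
open Complex

/-- Principal branch of the complex arccosine:
`arccos w = -i Log(w + i (1 - w²)^{1/2})`. -/
noncomputable def carccos (w : ℂ) : ℂ :=
  -Complex.I * Complex.log (w + Complex.I * (1 - w ^ 2) ^ ((1 : ℂ) / 2))

/-- `β(z) = √(z² − 1) − arccos(z⁻¹)` (principal branches). -/
noncomputable def betaFn (z : ℂ) : ℂ :=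
  (z ^ 2 - 1) ^ ((1 : ℂ) / 2) - carccos z⁻¹


lemma half_sq (a : ℂ) : (a ^ ((1 : ℂ) / 2)) ^ 2 = a := by
  have := Complex.cpow_nat_inv_pow a (n := 2) (by norm_num)
  rw [one_div]; exact_mod_cast this

lemma half_re {a : ℂ} (ha : a ∈ slitPlane) : 0 < (a ^ ((1 : ℂ) / 2)).re := by
  have h0 := slitPlane_ne_zero ha
  have h1 := (mem_slitPlane_iff_arg.1 ha).1
  rw [cpow_def_of_ne_zero h0, exp_re]
  have him : (log a * (1 / 2)).im = a.arg / 2 := by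
    rw [show (1 / 2 : ℂ) = ((1 / 2 : ℝ) : ℂ) by push_cast; rfl, im_mul_ofReal, log_im]; ring
  rw [him]
  have h2 := neg_pi_lt_arg a
  have h3 := lt_of_le_of_ne (arg_le_pi a) h1
  exact mul_pos (Real.exp_pos _) (Real.cos_pos_of_mem_Ioo ⟨by linarith, by linarith⟩)

lemma half_deriv {f : ℂ → ℂ} {f' z : ℂ} (hf : HasDerivAt f f' z) (h : f z ∈ slitPlane) :
    HasDerivAt (fun x => f x ^ ((1 : ℂ) / 2)) (f' / (2 * f z ^ ((1 : ℂ) / 2))) z := by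
  have h0 := slitPlane_ne_zero h
  convert hf.cpow_const (c := (1 : ℂ) / 2) h using 1
  rw [cpow_sub _ _ h0, cpow_one]
  have h1 := half_sq (f z)
  set s := f z ^ ((1 : ℂ) / 2)
  have hs : s ≠ 0 := by
    intro hs; rw [hs] at h1; apply h0; rw [← h1]; norm_num
  rw [← h1]
  field_simp

lemma beta_deriv {z : ℂ} (hz : 1 < z.re) :
    HasDerivAt betaFn ((1 - z⁻¹ ^ 2) ^ ((1 : ℂ) / 2)) z := by
  have hz0 : z ≠ 0 := by rintro rfl; norm_num at hz
  have hn : 1 < ‖z‖ := lt_of_lt_of_le hz (re_le_norm z)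
  have hS : z ^ 2 - 1 ∈ slitPlane := by
    rw [mem_slitPlane_iff]
    by_cases hy : z.im = 0
    · left; simp [pow_two, hy]; nlinarith
    · right; simp [pow_two]
      intro h; have : z.re * z.im = 0 := by linarith
      rcases mul_eq_zero.1 this with h | h
      · linarith
      · exact hy h
  have hs : 1 - z⁻¹ ^ 2 ∈ slitPlane := by
    rw [mem_slitPlane_iff]; left
    have h1 : ‖z⁻¹ ^ 2‖ < 1 := by
      rw [norm_pow, norm_inv]
      exact pow_lt_one₀ (by positivity) (inv_lt_one_of_one_lt₀ hn) (by norm_num)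
    have := re_le_norm (z⁻¹ ^ 2)
    rw [sub_re, one_re]; linarith
  have hwre : 0 < (z⁻¹).re := by
    rw [inv_re]; exact div_pos (by linarith) (normSq_pos.2 hz0)
  have dw : HasDerivAt (fun z : ℂ => z⁻¹) (-(z ^ 2)⁻¹) z := hasDerivAt_inv hz0
  have ds := half_deriv (f := fun z : ℂ => 1 - z⁻¹ ^ 2) ((dw.pow 2).const_sub 1) hs
  have dS := half_deriv (f := fun z : ℂ => z ^ 2 - 1) ((hasDerivAt_pow 2 z).sub_const 1) hS
  have s2 := half_sq (1 - z⁻¹ ^ 2)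
  have S2 := half_sq (z ^ 2 - 1)
  have sr := half_re hs
  have Sr := half_re hS
  have hL : z⁻¹ + I * (1 - z⁻¹ ^ 2) ^ ((1 : ℂ) / 2) ∈ slitPlane := by
    by_contra hc
    rw [mem_slitPlane_iff] at hc
    push Not at hc
    obtain ⟨h1, h2⟩ := hc
    set s := (1 - z⁻¹ ^ 2) ^ ((1 : ℂ) / 2)
    set t := z⁻¹ + I * s with ht
    have hp : t * (z⁻¹ - I * s) = 1 := by
      rw [ht]; linear_combination s2 - s ^ 2 * I_sq
    have e : t * (2 * z⁻¹ - t) = 1 := by rw [← hp, ht]; ring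
    have e1 := congrArg re e
    simp only [mul_re, sub_re, sub_im, mul_im, h2, one_re, re_ofNat, im_ofNat] at e1
    nlinarith
  have dL := (dw.add (ds.const_mul I)).clog hL
  have dB := dS.sub (dL.const_mul (-I))
  have hfun : betaFn = fun z : ℂ => (z ^ 2 - 1) ^ ((1 : ℂ) / 2) -
    (-I * log (z⁻¹ + I * (1 - z⁻¹ ^ 2) ^ ((1 : ℂ) / 2))) := by
    funext z; rfl
  rw [hfun]
  refine dB.congr_deriv ?_
  have hL0 := slitPlane_ne_zero hL
  simp only [Pi.add_apply]
  clear dB dL ds dS hL hfun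
  set s := (1 - z⁻¹ ^ 2) ^ ((1 : ℂ) / 2)
  set S := (z ^ 2 - 1) ^ ((1 : ℂ) / 2)
  have s0 : s ≠ 0 := by intro h; rw [h] at sr; simp at sr
  have hSs : S = z * s := by
    have : S ^ 2 = (z * s) ^ 2 := by
      rw [S2, mul_pow, s2]; field_simp
    rcases sq_eq_sq_iff_eq_or_eq_neg.1 this with h | h
    · exact h
    · exfalso
      have i2 := congrArg im S2
      simp [pow_two] at i2
      have r1 := congrArg re h
      have r2 := congrArg im h
      simp at r1 r2
      have k1 : S.re * z.re + S.im * z.im = - s.re * (z.re ^ 2 + z.im ^ 2) := by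
        rw [r1, r2]; ring
      have k2 : S.re * (S.im * z.im) = z.re * z.im ^ 2 := by linear_combination z.im / 2 * i2
      have k3 : 0 ≤ S.im * z.im := by
        by_contra hc; push Not at hc
        have := mul_neg_of_pos_of_neg Sr hc
        nlinarith [sq_nonneg z.im]
      have : 0 < S.re * z.re := mul_pos Sr (by linarith)
      have : 0 < s.re * (z.re ^ 2 + z.im ^ 2) := mul_pos sr (by nlinarith [sq_nonneg z.im])
      linarith
  have key : (-(z ^ 2)⁻¹ + I * (-((2:ℂ) * z⁻¹ * -(z ^ 2)⁻¹) / (2 * s))) / (z⁻¹ + I * s)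
      = I * (z ^ 2)⁻¹ / s := by
    rw [div_eq_div_iff hL0 s0]
    field_simp
    linear_combination -z * s * I_sq
  have h2 : z ^ 2 * s ^ 2 = z ^ 2 - 1 := by rw [s2]; field_simp
  rw [hSs]
  norm_num
  norm_num at key
  rw [key]
  field_simp
  linear_combination -h2 + I_sq

lemma beta_real {x : ℝ} (hx : 1 < x) : (betaFn x).im = 0 := by
  have e1 : ((x : ℂ) ^ 2 - 1) ^ ((1 : ℂ) / 2) = ((x ^ 2 - 1) ^ ((1 : ℝ) / 2) : ℝ) := by
    rw [ofReal_cpow (by nlinarith)]; push_cast; rfl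
  have hw : x⁻¹ ^ 2 < 1 := 
    pow_lt_one₀ (by positivity) (inv_lt_one_of_one_lt₀ hx) (by norm_num)
  have e2 : (1 - (x : ℂ)⁻¹ ^ 2) ^ ((1 : ℂ) / 2) = ((1 - x⁻¹ ^ 2) ^ ((1 : ℝ) / 2) : ℝ) := by
    rw [ofReal_cpow (by linarith)]; push_cast; rfl
  have h2 := half_sq (1 - (x : ℂ)⁻¹ ^ 2)
  rw [betaFn, carccos, e1, e2]
  rw [e2] at h2
  set s := (1 - x⁻¹ ^ 2) ^ ((1 : ℝ) / 2)
  have h3 : s ^ 2 = 1 - x⁻¹ ^ 2 := by exact_mod_cast h2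
  have hn : ‖(x : ℂ)⁻¹ + I * s‖ = 1 := by
    rw [← ofReal_inv, mul_comm, norm_add_mul_I, h3]; simp
  simp [log_re, hn]

theorem stmt_13 :
    ∃ C : ℝ, 0 < C ∧ ∀ z : ℂ, 1 < z.re → |(betaFn z).im| ≤ C * |z.im| := by
  refine ⟨2, by norm_num, fun z hz => ?_⟩
  have hb : ∀ w ∈ {w : ℂ | 1 < w.re}, ‖(1 - w⁻¹ ^ 2) ^ ((1 : ℂ) / 2)‖ ≤ 2 := by
    intro w hw
    have hn : 1 < ‖w‖ := lt_of_lt_of_le hw (re_le_norm w)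
    have h1 : ‖w⁻¹ ^ 2‖ < 1 := by
      rw [norm_pow, norm_inv]
      exact pow_lt_one₀ (by positivity) (inv_lt_one_of_one_lt₀ hn) (by norm_num)
    have h2 := congrArg norm (half_sq (1 - w⁻¹ ^ 2))
    rw [norm_pow] at h2
    have h3 := norm_sub_le (1 : ℂ) (w⁻¹ ^ 2)
    rw [norm_one] at h3
    nlinarith [norm_nonneg ((1 - w⁻¹ ^ 2) ^ ((1 : ℂ) / 2))]
  have := (convex_halfSpace_re_gt 1).norm_image_sub_le_of_norm_hasDerivWithin_le
    (f := betaFn) (fun w hw => (beta_deriv hw).hasDerivWithinAt) hb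
    (x := (z.re : ℂ)) (y := z) (by show 1 < ((z.re : ℂ)).re; rwa [ofReal_re]) hz
  have e : z - (z.re : ℂ) = z.im * I := by
    apply Complex.ext <;> simp
  rw [e] at this
  simp only [norm_mul, norm_I, mul_one, norm_real, Real.norm_eq_abs] at this
  have h2 := abs_im_le_norm (betaFn z - betaFn z.re)
  rw [sub_im, beta_real hz, sub_zero] at h2
  linarith
end

section
/- Fix c ∈ (0,1). The function G : (0,1) → ℂ defined by G(ε) = (1/(2π)) ∫_{−∞}^{∞} 2^{c+iy−1} · (Γ(1 − c − i y)/Γ(1 − (c+iy)/2)²) · ((1+ε)^{1−c−iy} − (1−ε)^{1−c−iy})/(1 − c − i y) dy satisfies G(ε) → 0 as ε → 0⁺. -/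
open MeasureTheory Complex Filter

/-- The vertical-line integral `G(ε)` on the line `Re z = c`. -/
noncomputable def GLimit (c ε : ℝ) : ℂ :=
  (1 / (2 * Real.pi) : ℂ) * ∫ y : ℝ,
    (2 : ℂ) ^ ((c : ℂ) + Complex.I * (y : ℂ) - 1) *
      (Complex.Gamma (1 - (c : ℂ) - Complex.I * (y : ℂ)) /
        (Complex.Gamma (1 - ((c : ℂ) + Complex.I * (y : ℂ)) / 2)) ^ 2) *
      (((1 + ε : ℝ) : ℂ) ^ (1 - (c : ℂ) - Complex.I * (y : ℂ)) -
        ((1 - ε : ℝ) : ℂ) ^ (1 - (c : ℂ) - Complex.I * (y : ℂ))) /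
      (1 - (c : ℂ) - Complex.I * (y : ℂ))


noncomputable def FSeq (u : ℂ) (n : ℕ) : ℂ :=
  Complex.GammaSeq u n * Complex.GammaSeq (u+1) n / (Complex.GammaSeq (u+1/2) n)^2

lemma FSeq_eq (u : ℂ) (hu : 0 < u.re) (n : ℕ) (hn : 0 < n) :
    FSeq u n = ∏ j ∈ Finset.range (n+1), (1 + 1/(4*((u+j)*(u+j+1)))) := by
  have hn0 : (n:ℂ) ≠ 0 := by exact_mod_cast hn.ne'
  have hne : ∀ (v : ℂ), 0 < v.re → ∀ j : ℕ, v + j ≠ 0 := by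
    intro v hv j h
    have := congrArg Complex.re h
    simp at this
    have : (0:ℝ) ≤ j := by positivity
    linarith
  have h1 : 0 < (u+1).re := by simp; linarith
  have h2 : 0 < (u+1/2).re := by simp; linarith
  have p1 : ∏ j ∈ Finset.range (n+1), (u+j) ≠ 0 := Finset.prod_ne_zero_iff.2 fun j _ => hne u hu j
  have p2 : ∏ j ∈ Finset.range (n+1), (u+1+j) ≠ 0 := Finset.prod_ne_zero_iff.2 fun j _ => hne _ h1 j
  have p3 : ∏ j ∈ Finset.range (n+1), (u+1/2+j) ≠ 0 := Finset.prod_ne_zero_iff.2 fun j _ => hne _ h2 j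
  have e : ∏ j ∈ Finset.range (n+1), (1 + 1/(4*((u+j)*(u+j+1)))) =
      (∏ j ∈ Finset.range (n+1), (u+1/2+j))^2 / ((∏ j ∈ Finset.range (n+1), (u+j)) * ∏ j ∈ Finset.range (n+1), (u+1+j)) := by
    rw [← Finset.prod_mul_distrib, ← Finset.prod_pow, ← Finset.prod_div_distrib]
    refine Finset.prod_congr rfl fun j _ => ?_
    have a := hne u hu j
    have b := hne _ h1 j
    have b' : u + j + 1 ≠ 0 := by convert b using 1; ring
    field_simp
    ring
  rw [e]
  unfold FSeq Complex.GammaSeq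
  have c1 : (n:ℂ)^u ≠ 0 := by simp [Complex.cpow_eq_zero_iff, hn0]
  have c3 : (n:ℂ)^(u+1/2) ≠ 0 := by simp [Complex.cpow_eq_zero_iff, hn0]
  have c4 : (n:ℂ)^u * (n:ℂ)^(u+1) = ((n:ℂ)^(u+1/2))^2 := by
    rw [← Complex.cpow_add _ _ hn0, sq, ← Complex.cpow_add _ _ hn0]; congr 1; ring
  have f : (n.factorial : ℂ) ≠ 0 := by exact_mod_cast n.factorial_ne_zero
  rw [div_mul_div_comm, div_pow, div_div_div_eq, div_eq_div_iff]
  · linear_combination ((n.factorial : ℂ))^2 * (∏ j ∈ Finset.range (n+1), (u+1/2+(j:ℂ)))^2 * (∏ j ∈ Finset.range (n+1), (u+(j:ℂ))) * (∏ j ∈ Finset.range (n+1), (u+1+(j:ℂ))) * c4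
  · positivity
  · positivity

lemma FSeq_tendsto (u : ℂ) (hu : 0 < u.re) : Tendsto (FSeq u) atTop
    (nhds (Complex.Gamma u * Complex.Gamma (u+1) / (Complex.Gamma (u+1/2))^2)) := by
  refine ((Complex.GammaSeq_tendsto_Gamma u).mul (Complex.GammaSeq_tendsto_Gamma _)).div
    ((Complex.GammaSeq_tendsto_Gamma _).pow 2) ?_
  refine pow_ne_zero _ (Complex.Gamma_ne_zero_of_re_pos ?_)
  simp; linarith

lemma F_le (u : ℂ) (hu : 0 < u.re) :
    ‖Complex.Gamma u * Complex.Gamma (u+1) / (Complex.Gamma (u+1/2))^2‖ ≤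
    ‖Complex.Gamma (u.re:ℂ) * Complex.Gamma ((u.re:ℂ)+1) / (Complex.Gamma ((u.re:ℂ)+1/2))^2‖ := by
  refine le_of_tendsto_of_tendsto (FSeq_tendsto u hu).norm
    (FSeq_tendsto (u.re:ℂ) (by simpa using hu)).norm ?_
  filter_upwards [eventually_gt_atTop 0] with n hn
  rw [FSeq_eq u hu n hn, FSeq_eq _ (by simpa using hu) n hn, norm_prod, norm_prod]
  refine Finset.prod_le_prod (fun _ _ => norm_nonneg _) fun j _ => ?_
  have hj : (0:ℝ) ≤ j := by positivity
  have r : ‖(1:ℂ) + 1/(4*(((u.re:ℂ)+j)*((u.re:ℂ)+j+1)))‖ = 1 + 1/(4*((u.re+j)*(u.re+j+1))) := by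
    have : (1:ℂ) + 1/(4*(((u.re:ℂ)+j)*((u.re:ℂ)+j+1))) = ((1 + 1/(4*((u.re+j)*(u.re+j+1))) : ℝ) : ℂ) := by
      push_cast; ring
    rw [this, Complex.norm_of_nonneg (by positivity)]
  rw [r]
  refine (norm_add_le _ _).trans ?_
  have a1 : u.re + j ≤ ‖u + j‖ := by simpa using Complex.re_le_norm (u+j)
  have a2 : u.re + j + 1 ≤ ‖u + j + 1‖ := by simpa using Complex.re_le_norm (u+j+1)
  rw [norm_one, norm_div, norm_mul, norm_mul, norm_one]
  have : ‖(4:ℂ)‖ = 4 := by norm_num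
  rw [this]
  gcongr

lemma R_le (u : ℂ) (hu : 0 < u.re) : ‖Complex.Gamma u / Complex.Gamma (u+1/2)‖^2 ≤
    ‖Complex.Gamma (u.re:ℂ) * Complex.Gamma ((u.re:ℂ)+1) / (Complex.Gamma ((u.re:ℂ)+1/2))^2‖ / ‖u‖ := by
  have hu0 : u ≠ 0 := by rintro rfl; simp at hu
  rw [le_div_iff₀ (norm_pos_iff.2 hu0)]
  refine le_trans (le_of_eq ?_) (F_le u hu)
  rw [Complex.Gamma_add_one u hu0, ← norm_pow, ← norm_mul]
  congr 1; ring

lemma K_eq (w : ℂ) (hw : 0 < w.re) :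
    (2:ℂ)^(-w) * (Complex.Gamma w / (Complex.Gamma (w/2+1/2))^2) =
      (Complex.Gamma (w/2) / Complex.Gamma (w/2+1/2)) / (2 * (√Real.pi : ℝ)) := by
  have hg : Complex.Gamma (w/2+1/2) ≠ 0 := by
    refine Complex.Gamma_ne_zero_of_re_pos ?_
    have : (w/2+1/2).re = w.re/2 + 1/2 := by simp
    rw [this]; linarith
  have hp : ((√Real.pi : ℝ) : ℂ) ≠ 0 := by
    have : (√Real.pi : ℝ) ≠ 0 := by positivity
    exact_mod_cast this
  have h := Complex.Gamma_mul_Gamma_add_half (w/2)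
  rw [show 2 * (w/2) = w by ring, show (1:ℂ) - w = 1 + -w by ring,
    Complex.cpow_add _ _ (by norm_num), Complex.cpow_one] at h
  generalize Complex.Gamma (w/2+1/2) = g at *
  field_simp
  linear_combination -h

lemma K_le (w : ℂ) (hw : 0 < w.re) :
    ‖(2:ℂ)^(-w) * (Complex.Gamma w / (Complex.Gamma (w/2+1/2))^2)‖ ≤
      ‖Complex.Gamma (w/2) / Complex.Gamma (w/2+1/2)‖ := by
  rw [K_eq w hw, norm_div]
  refine div_le_self (norm_nonneg _) ?_
  rw [norm_mul, Complex.norm_of_nonneg (by positivity)]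
  have : 1 ≤ √Real.pi := by
    rw [Real.one_le_sqrt]; linarith [Real.pi_gt_three]
  have h2 : ‖(2:ℂ)‖ = 2 := by norm_num
  rw [h2]; linarith

theorem stmt_16 (c : ℝ) (hc : c ∈ Set.Ioo (0:ℝ) 1) :
    Tendsto (fun ε : ℝ => GLimit c ε) (nhdsWithin 0 (Set.Ioo (0:ℝ) 1)) (nhds 0) := by
  obtain ⟨hc0, hc1⟩ := hc
  set d : ℝ := 1 - c with hd
  have hd0 : 0 < d := by linarith
  have hd1 : d < 1 := by linarith
  have hwre : ∀ y : ℝ, (1 - (c:ℂ) - Complex.I * (y:ℂ)).re = d := by intro y; simp [hd]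
  have hwim : ∀ y : ℝ, (1 - (c:ℂ) - Complex.I * (y:ℂ)).im = -y := by intro y; simp
  have hrw : ∀ y : ℝ, 1 - ((c:ℂ) + Complex.I * (y:ℂ)) / 2 =
      (1 - (c:ℂ) - Complex.I * (y:ℂ)) / 2 + 1/2 := by intro y; ring
  have hrw2 : ∀ y : ℝ, (c:ℂ) + Complex.I * (y:ℂ) - 1 = -(1 - (c:ℂ) - Complex.I * (y:ℂ)) := by
    intro y; ring
  have hw0 : ∀ y : ℝ, (1 - (c:ℂ) - Complex.I * (y:ℂ)) ≠ 0 := by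
    intro y h; have := hwre y; rw [h] at this; simp at this; linarith
  have hwc : Continuous fun y : ℝ => (1 - (c:ℂ) - Complex.I * (y:ℂ)) := by fun_prop
  set M : ℝ := ‖Complex.Gamma ((d/2:ℝ):ℂ) * Complex.Gamma (((d/2:ℝ):ℂ)+1) /
    (Complex.Gamma (((d/2:ℝ):ℂ)+1/2))^2‖ with hM
  have hM0 : 0 ≤ M := norm_nonneg _
  unfold GLimit
  simp only [hrw, hrw2]
  rw [show (nhds (0:ℂ)) = nhds ((1 / (2 * Real.pi) : ℂ) * ∫ y : ℝ, (0:ℂ)) by simp]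
  refine Tendsto.const_mul _ ?_
  refine tendsto_integral_filter_of_dominated_convergence
    (fun y : ℝ => (√(2 * M / d) * 4 / d) * (1 + ‖y‖^2) ^ (-(3/2:ℝ)/2)) ?_ ?_ ?_ ?_
  · filter_upwards [self_mem_nhdsWithin] with ε hε
    refine Continuous.aestronglyMeasurable ?_
    have g1 : Continuous fun y : ℝ => Complex.Gamma (1 - (c:ℂ) - Complex.I * (y:ℂ)) := by
      rw [continuous_iff_continuousAt]; intro y
      refine ContinuousAt.comp (f := fun y : ℝ => (1 - (c:ℂ) - Complex.I * (y:ℂ)))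
        (g := Complex.Gamma) ?_ hwc.continuousAt
      refine (Complex.differentiableAt_Gamma _ fun m h => ?_).continuousAt
      have := hwre y; rw [h] at this; simp at this
      have : (0:ℝ) ≤ m := by positivity
      linarith
    have r2 : ∀ y : ℝ, ((1 - (c:ℂ) - Complex.I * (y:ℂ)) / 2 + 1/2).re = d/2 + 1/2 := by
      intro y; simp [hd]
    have g2 : Continuous fun y : ℝ => Complex.Gamma ((1 - (c:ℂ) - Complex.I * (y:ℂ)) / 2 + 1/2) := by
      rw [continuous_iff_continuousAt]; intro y
      refine ContinuousAt.comp (f := fun y : ℝ => ((1 - (c:ℂ) - Complex.I * (y:ℂ)) / 2 + 1/2))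
        (g := Complex.Gamma) ?_ (by fun_prop)
      refine (Complex.differentiableAt_Gamma _ fun m h => ?_).continuousAt
      have := r2 y; rw [h] at this; simp at this
      have : (0:ℝ) ≤ m := by positivity
      linarith
    have k1 : Continuous fun y : ℝ => (2:ℂ) ^ (-(1 - (c:ℂ) - Complex.I * (y:ℂ))) :=
      hwc.neg.const_cpow (Or.inl (by norm_num))
    have k2 : Continuous fun y : ℝ => ((1+ε:ℝ):ℂ) ^ ((1 - (c:ℂ) - Complex.I * (y:ℂ))) :=
      hwc.const_cpow (Or.inl (by have : 1 + ε ≠ 0 := by linarith [hε.1]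
                                 exact_mod_cast this))
    have k3 : Continuous fun y : ℝ => ((1-ε:ℝ):ℂ) ^ ((1 - (c:ℂ) - Complex.I * (y:ℂ))) :=
      hwc.const_cpow (Or.inl (by have : 1 - ε ≠ 0 := by linarith [hε.2]
                                 exact_mod_cast this))
    refine ((k1.mul (g1.div (g2.pow 2) ?_)).mul (k2.sub k3)).div hwc hw0
    intro y
    refine pow_ne_zero _ (Complex.Gamma_ne_zero_of_re_pos ?_)
    rw [r2]; linarith
  · filter_upwards [self_mem_nhdsWithin] with ε hε
    refine Eventually.of_forall fun y => ?_
    set w : ℂ := 1 - (c:ℂ) - Complex.I * (y:ℂ) with hw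
    have hwr : w.re = d := hwre y
    have hwi : w.im = -y := hwim y
    have hK := K_le w (by rw [hwr]; exact hd0)
    have hu : (w/2).re = d/2 := by simp [hwr]
    have hR := R_le (w/2) (by rw [hu]; linarith)
    rw [hu, ← hM] at hR
    set q : ℝ := √(1 + ‖y‖^2) with hq
    have hq0 : 0 < q := Real.sqrt_pos.2 (by positivity)
    have hwq : d * q ≤ ‖w‖ := by
      refine abs_le_of_sq_le_sq' ?_ (norm_nonneg _) |>.2
      rw [mul_pow, hq, Real.sq_sqrt (by positivity), Complex.sq_norm, Complex.normSq_apply, hwr, hwi,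
        Real.norm_eq_abs, sq_abs]
      nlinarith [mul_nonneg (sq_nonneg y) (show 0 ≤ 1 - d^2 by nlinarith)]
    have hRR : ‖Complex.Gamma (w/2) / Complex.Gamma (w/2+1/2)‖ ≤ √(2 * M / d / q) := by
      refine Real.le_sqrt_of_sq_le (hR.trans ?_)
      have : ‖w/2‖ = ‖w‖/2 := by simp
      rw [this, div_div_eq_mul_div, div_div, mul_comm M 2]
      gcongr
    have hpow : ∀ x : ℝ, 0 < x → x ≤ 2 → ‖(x:ℂ)^w‖ ≤ 2 := by
      intro x hx hx2
      rw [Complex.norm_cpow_eq_rpow_re_of_pos hx, hwr]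
      calc x^d ≤ 2^d := by gcongr
        _ ≤ 2^(1:ℝ) := Real.rpow_le_rpow_of_exponent_le (by norm_num) hd1.le
        _ = 2 := by simp
    have hdiff : ‖((1 + ε : ℝ) : ℂ)^w - ((1 - ε : ℝ) : ℂ)^w‖ ≤ 4 := by
      refine (norm_sub_le _ _).trans ?_
      have := hpow (1+ε) (by linarith [hε.1]) (by linarith [hε.2])
      have := hpow (1-ε) (by linarith [hε.2]) (by linarith [hε.1])
      linarith
    have hqq : (1 + ‖y‖^2) ^ (-(3/2:ℝ)/2) = (√q)⁻¹ * q⁻¹ := by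
      have h1 : (1 + ‖y‖^2) = q^(2:ℝ) := by
        rw [hq, Real.rpow_two, Real.sq_sqrt (by positivity)]
      rw [h1, ← Real.rpow_mul hq0.le, Real.sqrt_eq_rpow, ← Real.rpow_neg hq0.le,
        ← Real.rpow_neg_one q, ← Real.rpow_add hq0]
      norm_num
    rw [norm_div, norm_mul, hqq]
    calc _ ≤ √(2 * M / d / q) * 4 / (d * q) := by
          gcongr
          exact hK.trans hRR
      _ = _ := by
          rw [Real.sqrt_div (by positivity)]
          field_simp
  · refine Integrable.const_mul ?_ _
    exact integrable_rpow_neg_one_add_norm_sq (by norm_num)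
  · refine Eventually.of_forall fun y => ?_
    refine Tendsto.mono_left ?_ nhdsWithin_le_nhds
    set w : ℂ := 1 - (c:ℂ) - Complex.I * (y:ℂ) with hw
    have hcont : ContinuousAt (fun ε : ℝ => (2:ℂ)^(-w) * (Complex.Gamma w / (Complex.Gamma (w/2+1/2))^2)
        * (((1 + ε : ℝ) : ℂ)^w - ((1 - ε : ℝ) : ℂ)^w) / w) 0 := by
      have e1 : ContinuousAt (fun ε : ℝ => ((1 + ε : ℝ) : ℂ)^w) 0 :=
        ContinuousAt.cpow (by fun_prop) continuousAt_const (by simp)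
      have e2 : ContinuousAt (fun ε : ℝ => ((1 - ε : ℝ) : ℂ)^w) 0 :=
        ContinuousAt.cpow (by fun_prop) continuousAt_const (by simp)
      exact (continuousAt_const.mul (e1.sub e2)).div_const _
    have := hcont.tendsto
    simpa using this
end
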